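/- arXiv:1207.3429 — 13 statements merged into one kernel-verified Lean document; each statement's English description precedes it below -/
import Mathlib

section
/- Let n ≥ 1 and let Φ, Φ⁺ be the type A_n root system and its positive roots in ℝ^{n+1}. Then the convex hull of Φ⁺ ∪ {0} equals the intersection of the convex hull of Φ with the cone 𝒞⁺ of all nonnegative real linear combinations of the positive roots (equivalently, of the simple roots): conv(Φ⁺ ∪ {0}) = conv(Φ) ∩ 𝒞⁺. -/
/-- A transport plan (the north-west corner rule) moving mass `p` to mass `q` strictly to the
right, whenever the partial sums of `p` dominate those of `q`. -/
theorem exists_rightward_transport (N : ℕ) (p q : ℕ → ℝ) (hp : ∀ m, 0 ≤ p m) (hq : ∀ m, 0 ≤ q m)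
    (hdisj : ∀ m, p m = 0 ∨ q m = 0)
    (hle : ∀ k ≤ N, ∑ m ∈ Finset.range k, q m ≤ ∑ m ∈ Finset.range k, p m)
    (htot : ∑ m ∈ Finset.range N, p m = ∑ m ∈ Finset.range N, q m) :
    ∃ c : ℕ → ℕ → ℝ, (∀ i j, 0 ≤ c i j) ∧ (∀ i < N, ∀ j < N, ¬ i < j → c i j = 0) ∧
      (∀ i < N, ∑ j ∈ Finset.range N, c i j = p i) ∧
      (∀ j < N, ∑ i ∈ Finset.range N, c i j = q j) := by
  set P : ℕ → ℝ := fun k => ∑ m ∈ Finset.range k, p m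
  set Q : ℕ → ℝ := fun k => ∑ m ∈ Finset.range k, q m
  have hPs : ∀ k, P (k + 1) = P k + p k := fun k => Finset.sum_range_succ _ _
  have hQs : ∀ k, Q (k + 1) = Q k + q k := fun k => Finset.sum_range_succ _ _
  have hP0 : P 0 = 0 := Finset.sum_range_zero _
  have hQ0 : Q 0 = 0 := Finset.sum_range_zero _
  have hPm : Monotone P := monotone_nat_of_le_succ fun k => by linarith [hPs k, hp k]
  have hQm : Monotone Q := monotone_nat_of_le_succ fun k => by linarith [hQs k, hq k]
  have hPQ : P N = Q N := htot
  have hnonnegP : ∀ k, 0 ≤ P k := fun k => hP0 ▸ hPm (Nat.zero_le k)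
  have hnonnegQ : ∀ k, 0 ≤ Q k := fun k => hQ0 ▸ hQm (Nat.zero_le k)
  refine ⟨fun i j => (min (P (i + 1)) (Q (j + 1)) - min (P i) (Q (j + 1))) -
    (min (P (i + 1)) (Q j) - min (P i) (Q j)), ?_, ?_, ?_, ?_⟩
  · intro i j
    have h1 := hPm (Nat.le_succ i)
    have h2 := hQm (Nat.le_succ j)
    simp only [Nat.succ_eq_add_one] at h1 h2
    simp only [min_def]
    split_ifs <;> linarith
  · intro i hi j hj hij
    rcases (not_lt.mp hij).eq_or_lt with h | h
    · subst h
      rcases hdisj j with h0 | h0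
      · simp [hPs j, h0]
      · simp [hQs j, h0]
    · have h1 := hQm (Nat.le_succ j)
      have h2 : Q (j + 1) ≤ P (j + 1) := hle _ hj
      have h3 : P (j + 1) ≤ P i := hPm h
      have h4 := hPm (Nat.le_succ i)
      simp only [Nat.succ_eq_add_one] at h1 h4
      dsimp only
      rw [min_eq_right (by linarith), min_eq_right (by linarith), min_eq_right (by linarith),
        min_eq_right (by linarith)]
      ring
  · intro i hi
    rw [Finset.sum_range_sub (fun j => min (P (i + 1)) (Q j) - min (P i) (Q j)), ← hPQ,
      min_eq_left (hPm hi), min_eq_left (hPm hi.le), hQ0, min_eq_right (hnonnegP _),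
      min_eq_right (hnonnegP _), hPs]
    ring
  · intro j hj
    have := Finset.sum_range_sub (fun i => min (P i) (Q (j + 1)) - min (P i) (Q j)) N
    rw [hPQ, min_eq_right (hQm hj), min_eq_right (hQm hj.le), hP0, min_eq_left (hnonnegQ _),
      min_eq_left (hnonnegQ _)] at this
    refine (Finset.sum_congr rfl fun i _ => ?_).trans (this.trans ?_)
    · ring
    · linarith [hQs j]

/-- A subconvex combination of points of a convex set containing `0` stays in the set. -/
theorem Convex.sum_smul_mem_of_zero_mem {E ι : Type*} [AddCommGroup E] [Module ℝ E] [Fintype ι]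
    {s : Set E} (hs : Convex ℝ s) (h0 : (0 : E) ∈ s) {w : ι → ℝ} {z : ι → E}
    (hw : ∀ i, 0 ≤ w i) (hw1 : ∑ i, w i ≤ 1) (hz : ∀ i, z i ∈ s) : ∑ i, w i • z i ∈ s := by
  have := hs.sum_mem (t := Finset.univ) (w := fun o : Option ι => o.elim (1 - ∑ i, w i) w)
    (z := fun o => o.elim 0 z) (by rintro (_ | i) - <;> simp [hw, hw1])
    (by simp [Fintype.sum_option]) (by rintro (_ | i) - <;> simp [h0, hz])
  simpa [Fintype.sum_option] using this

/-- A vector with zero sum, nonnegative partial sums and total positive part at most `1` lies in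
the convex hull of the positive roots of type `A` together with `0`. -/
theorem mem_convexHull_positiveRoots {n : ℕ} {x : Fin (n + 1) → ℝ}
    (hpart : ∀ k ≤ n + 1, 0 ≤ ∑ m ∈ Finset.range k, x (Fin.ofNat (n + 1) m))
    (hsum : ∑ i, x i = 0) (hpos : ∑ i, max (x i) 0 ≤ 1) :
    x ∈ convexHull ℝ ({v : Fin (n + 1) → ℝ | ∃ i j : Fin (n + 1), i < j ∧
      v = Pi.single i 1 - Pi.single j 1} ∪ {0}) := by
  have hval : ∀ i : Fin (n + 1), Fin.ofNat (n + 1) i = i := fun i => by simp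
  have hsub : ∀ t : ℝ, max t 0 - max (-t) 0 = t := fun t => by
    rcases le_total t 0 with h | h <;> simp [h]
  have hdiff : ∀ k, ∑ m ∈ Finset.range k, max (x (Fin.ofNat (n + 1) m)) 0 -
      ∑ m ∈ Finset.range k, max (-x (Fin.ofNat (n + 1) m)) 0 =
      ∑ m ∈ Finset.range k, x (Fin.ofNat (n + 1) m) := fun k => by
    rw [← Finset.sum_sub_distrib]
    exact Finset.sum_congr rfl fun m _ => hsub _
  have htot : ∑ m ∈ Finset.range (n + 1), x (Fin.ofNat (n + 1) m) = 0 := by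
    rw [← Fin.sum_univ_eq_sum_range (fun m => x (Fin.ofNat (n + 1) m))]
    simpa only [hval] using hsum
  obtain ⟨c, hc0, hcz, hcp, hcq⟩ := exists_rightward_transport (n + 1)
    (fun m => max (x (Fin.ofNat (n + 1) m)) 0) (fun m => max (-x (Fin.ofNat (n + 1) m)) 0)
    (fun _ => le_max_right _ _) (fun _ => le_max_right _ _)
    (fun m => (le_total (x (Fin.ofNat (n + 1) m)) 0).imp max_eq_right
      fun h => max_eq_right (neg_nonpos.mpr h))
    (fun k hk => by linarith [hdiff k, hpart k hk]) (by linarith [hdiff (n + 1)])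
  have hrow : ∀ i : Fin (n + 1), ∑ j : Fin (n + 1), c i j = max (x i) 0 := fun i => by
    rw [Fin.sum_univ_eq_sum_range (fun j => c i j), hcp i i.isLt, hval]
  have hcol : ∀ j : Fin (n + 1), ∑ i : Fin (n + 1), c i j = max (-x j) 0 := fun j => by
    rw [Fin.sum_univ_eq_sum_range (fun i => c i j), hcq j j.isLt, hval]
  have hx : x = ∑ a : Fin (n + 1) × Fin (n + 1), c a.1 a.2 •
      (if a.1 < a.2 then Pi.single a.1 1 - Pi.single a.2 1 else 0 : Fin (n + 1) → ℝ) := by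
    have hif : ∀ i j : Fin (n + 1), c i j •
        (if i < j then Pi.single i 1 - Pi.single j 1 else 0 : Fin (n + 1) → ℝ) =
        c i j • Pi.single i 1 - c i j • Pi.single j 1 := fun i j => by
      split_ifs with h
      · rw [smul_sub]
      · simp [hcz i i.isLt j j.isLt h]
    rw [Fintype.sum_prod_type]
    simp only [hif, Finset.sum_sub_distrib]
    rw [Finset.sum_comm (f := fun i j : Fin (n + 1) =>
      c i j • (Pi.single j 1 : Fin (n + 1) → ℝ))]
    simp only [← Finset.sum_smul, hrow, hcol]
    rw [← Finset.sum_sub_distrib]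
    simp only [← sub_smul, hsub]
    exact pi_eq_sum_univ' x
  rw [hx]
  refine (convex_convexHull ℝ _).sum_smul_mem_of_zero_mem (subset_convexHull ℝ _ (by simp))
    (fun a => hc0 _ _) ?_ fun a => ?_
  · rw [Fintype.sum_prod_type]
    simpa only [hrow] using hpos
  · apply subset_convexHull ℝ _
    split_ifs with h
    · exact Or.inl ⟨_, _, h, rfl⟩
    · exact Or.inr rfl

/-- Type A_n: the positive root polytope equals the intersection of the root polytope
with the cone of nonnegative combinations of positive roots. -/
theorem typeA_positive_polytope_eq_inter_cone (n : ℕ) (hn : 1 ≤ n)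
    (e : Fin (n+1) → (Fin (n+1) → ℝ))
    (he : ∀ i, e i = fun k => if k = i then (1 : ℝ) else 0)
    (Φ Φpos Cpos : Set (Fin (n+1) → ℝ))
    (hΦ : Φ = {v | ∃ i j : Fin (n+1), i ≠ j ∧ v = e i - e j})
    (hΦpos : Φpos = {v | ∃ i j : Fin (n+1), i < j ∧ v = e i - e j})
    (hC : Cpos = {x | ∃ c : Fin (n+1) → Fin (n+1) → ℝ,
        (∀ i j, 0 ≤ c i j) ∧
        x = ∑ i : Fin (n+1), ∑ j : Fin (n+1),
              (if i < j then c i j • (e i - e j) else 0)}) :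
    convexHull ℝ (Φpos ∪ {0}) = convexHull ℝ Φ ∩ Cpos := by
  have hsingle : ∀ i, e i = Pi.single i 1 := fun i => by
    ext k
    simp [he, Pi.single_apply]
  simp only [hsingle] at hΦ hΦpos hC
  subst hΦ hΦpos hC
  apply subset_antisymm
  · apply convexHull_min
    · rintro v (⟨i, j, hij, rfl⟩ | rfl)
      · refine ⟨subset_convexHull ℝ _ ⟨i, j, hij.ne, rfl⟩,
          fun a b => if a = i ∧ b = j then 1 else 0, fun a b => by positivity, ?_⟩
        rw [Finset.sum_eq_single i, Finset.sum_eq_single j]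
        · simp [hij]
        · intro b _ hb
          simp [hb]
        · simp
        · intro a _ ha
          simp [ha]
        · simp
      · refine ⟨?_, 0, by simp, by simp⟩
        have h01 : (0 : Fin (n + 1)) ≠ Fin.last n := fun h => by
          simp only [Fin.ext_iff, Fin.val_zero, Fin.val_last] at h
          omega
        have := convex_convexHull ℝ {v : Fin (n + 1) → ℝ | ∃ i j : Fin (n + 1), i ≠ j ∧
          v = Pi.single i 1 - Pi.single j 1}
          (subset_convexHull ℝ _ ⟨0, Fin.last n, h01, rfl⟩)
          (subset_convexHull ℝ _ ⟨Fin.last n, 0, h01.symm, rfl⟩)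
          (a := 1 / 2) (b := 1 / 2) (by norm_num) (by norm_num) (by norm_num)
        rwa [← smul_add, sub_add_sub_cancel, sub_self, smul_zero] at this
    · refine (convex_convexHull ℝ _).inter ?_
      rintro _ ⟨c, hc, rfl⟩ _ ⟨d, hd, rfl⟩ a b ha hb -
      refine ⟨fun i j => a * c i j + b * d i j, fun i j =>
        add_nonneg (mul_nonneg ha (hc i j)) (mul_nonneg hb (hd i j)), ?_⟩
      simp only [Finset.smul_sum, ← Finset.sum_add_distrib]
      refine Finset.sum_congr rfl fun i _ => Finset.sum_congr rfl fun j _ => ?_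
      split_ifs
      · rw [add_smul, mul_smul, mul_smul]
      · simp
  · rintro x ⟨hx, c, hc, hxc⟩
    apply mem_convexHull_positiveRoots
    · intro k hk
      have hone : ∀ i : Fin (n + 1), ∑ m ∈ Finset.range k,
          (Pi.single i 1 : Fin (n + 1) → ℝ) (Fin.ofNat (n + 1) m) =
          if (i : ℕ) < k then 1 else 0 := fun i => by
        simp only [← Finset.mem_range]
        rw [← Finset.sum_ite_eq' (Finset.range k) (i : ℕ) (fun _ => (1 : ℝ))]
        refine Finset.sum_congr rfl fun m hm => ?_
        have hm' : m < n + 1 := (Finset.mem_range.mp hm).trans_le hk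
        simp [Pi.single_apply, Fin.ext_iff, Nat.mod_eq_of_lt hm']
      rw [hxc]
      simp only [Finset.sum_apply]
      rw [Finset.sum_comm]
      refine Finset.sum_nonneg fun i _ => ?_
      rw [Finset.sum_comm]
      refine Finset.sum_nonneg fun j _ => ?_
      split_ifs with hij
      · simp only [Pi.smul_apply, Pi.sub_apply, smul_eq_mul, ← Finset.mul_sum,
          Finset.sum_sub_distrib, hone]
        refine mul_nonneg (hc i j) ?_
        have : (i : ℕ) < j := hij
        split_ifs <;> first | omega | norm_num
      · simp
    · rw [hxc]
      simp only [Finset.sum_apply]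
      rw [Finset.sum_comm]
      refine Finset.sum_eq_zero fun i _ => ?_
      rw [Finset.sum_comm]
      refine Finset.sum_eq_zero fun j _ => ?_
      split_ifs
      · simp [← Finset.mul_sum]
      · simp
    · have hconv : Convex ℝ {x : Fin (n + 1) → ℝ | ∑ i, max (x i) 0 ≤ 1} := by
        intro y hy z hz a b ha hb hab
        calc ∑ i, max ((a • y + b • z) i) 0
            ≤ ∑ i, (a * max (y i) 0 + b * max (z i) 0) := Finset.sum_le_sum fun i _ =>
              max_le (add_le_add (mul_le_mul_of_nonneg_left (le_max_left _ _) ha)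
                (mul_le_mul_of_nonneg_left (le_max_left _ _) hb)) (by positivity)
          _ = a * ∑ i, max (y i) 0 + b * ∑ i, max (z i) 0 := by
              rw [Finset.sum_add_distrib, Finset.mul_sum, Finset.mul_sum]
          _ ≤ a * 1 + b * 1 := add_le_add (mul_le_mul_of_nonneg_left hy ha)
              (mul_le_mul_of_nonneg_left hz hb)
          _ = 1 := by linarith
      refine convexHull_min ?_ hconv hx
      rintro v ⟨i, j, -, rfl⟩
      calc ∑ k, max ((Pi.single i 1 - Pi.single j 1 : Fin (n + 1) → ℝ) k) 0
          ≤ ∑ k, (Pi.single i 1 : Fin (n + 1) → ℝ) k := Finset.sum_le_sum fun k _ => by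
            simp only [Pi.sub_apply, Pi.single_apply]
            split_ifs <;> norm_num
        _ ≤ 1 := by simp
end

section
/- Let n ≥ 1 and let Φ, Φ⁺ be the type C_n root system and its positive roots in ℝ^n. Then the convex hull of Φ⁺ ∪ {0} equals the intersection of the convex hull of Φ with the cone 𝒞⁺ of all nonnegative real linear combinations of the positive roots: conv(Φ⁺ ∪ {0}) = conv(Φ) ∩ 𝒞⁺. -/
open scoped Pointwise in
/-- Let `K` be a convex set containing `0` and all positive roots of type `C`. A vector with
nonnegative initial sums lies in `K` scaled by half of its `ℓ¹` norm. -/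
theorem mem_half_sum_abs_smul_of_initial_sums_nonneg {n : ℕ} {K : Set (Fin n → ℝ)}
    (hK : Convex ℝ K) (h0 : (0 : Fin n → ℝ) ∈ K)
    (hsub : ∀ i j : Fin n, i < j → Pi.single i (1 : ℝ) - Pi.single j 1 ∈ K)
    (hdiag : ∀ i : Fin n, Pi.single i (1 : ℝ) + Pi.single i 1 ∈ K)
    (x : Fin n → ℝ) (hx : ∀ k, 0 ≤ ∑ l ∈ Finset.Iic k, x l) :
    x ∈ ((∑ l, |x l|) / 2) • K := by
  induction hm : (Finset.univ.filter fun l => x l ≠ 0).card using Nat.strong_induction_on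
    generalizing x with
  | _ m ih =>
  -- The reduction step: split off a multiple of an element of `K`.
  have step : ∀ (t : ℝ) (v x' : Fin n → ℝ) (i : Fin n), 0 ≤ t → v ∈ K → x = t • v + x' →
      (∀ l, x l = 0 → x' l = 0) → x i ≠ 0 → x' i = 0 →
      (∀ k, 0 ≤ ∑ l ∈ Finset.Iic k, x' l) → ∑ l, |x l| = 2 * t + ∑ l, |x' l| →
      x ∈ ((∑ l, |x l|) / 2) • K := by
    intro t v x' i ht hv hxx hsupp hi hi' hpos hsum
    have hcard : (Finset.univ.filter fun l => x' l ≠ 0).card < m := by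
      rw [← hm]
      refine Finset.card_lt_card ⟨fun l hl => ?_, fun h => ?_⟩
      · simp only [Finset.mem_filter, Finset.mem_univ, true_and] at hl ⊢
        exact fun h => hl (hsupp l h)
      · have := @h i (by simpa using hi)
        simp [hi'] at this
    have hmem := ih _ hcard x' hpos rfl
    have hs : (∑ l, |x l|) / 2 = t + (∑ l, |x' l|) / 2 := by rw [hsum]; ring
    rw [hs, hK.add_smul ht (by positivity)]
    nth_rewrite 1 [hxx]
    exact Set.add_mem_add (Set.smul_mem_smul_set hv) hmem
  by_cases hneg : ∃ j, x j < 0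
  · obtain ⟨j, hj, hmin⟩ : ∃ j, x j < 0 ∧ ∀ l < j, 0 ≤ x l := by
      obtain ⟨j, hj, hmin⟩ := WellFounded.has_min (wellFounded_lt (α := Fin n)) {j | x j < 0} hneg
      exact ⟨j, hj, fun l hl => not_lt.1 fun h => hmin l h hl⟩
    obtain ⟨i, hij, hi⟩ : ∃ i < j, 0 < x i := by
      by_contra! h
      have hlt : ∑ l ∈ Finset.Iic j, x l < 0 := by
        refine Finset.sum_neg' (fun l hl => ?_) ⟨j, by simp, hj⟩
        rcases (Finset.mem_Iic.1 hl).lt_or_eq with h1 | rfl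
        · exact h l h1
        · exact hj.le
      exact absurd (hx j) (not_le.2 hlt)
    obtain ⟨t, ht, hti, htj, hor⟩ : ∃ t : ℝ, 0 ≤ t ∧ t ≤ x i ∧ t ≤ -x j ∧ (t = x i ∨ t = -x j) := by
      refine ⟨min (x i) (-x j), ?_, min_le_left _ _, min_le_right _ _, min_choice _ _⟩
      exact le_min hi.le (by linarith)
    have hne : i ≠ j := hij.ne
    let x' : Fin n → ℝ := x - t • (Pi.single i (1 : ℝ) - Pi.single j 1)
    have hx' : ∀ l, x' l = x l - (if l = i then t else 0) + (if l = j then t else 0) := by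
      intro l
      simp only [x', Pi.sub_apply, Pi.smul_apply, Pi.single_apply, smul_eq_mul]
      split_ifs <;> ring
    have hxi : x' i = x i - t := by simp [hx', hne]
    have hxj : x' j = x j + t := by simp [hx', hne.symm]
    have hxl : ∀ l, l ≠ i → l ≠ j → x' l = x l := by
      intro l h1 h2; simp [hx', h1, h2]
    have hsupp : ∀ l, x l = 0 → x' l = 0 := by
      intro l hl
      rw [hxl l (by rintro rfl; exact hi.ne' hl) (by rintro rfl; exact hj.ne hl), hl]
    have hpos : ∀ k, 0 ≤ ∑ l ∈ Finset.Iic k, x' l := by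
      intro k
      rcases lt_or_ge k j with hkj | hkj
      · refine Finset.sum_nonneg fun l hl => ?_
        have hlj : l < j := (Finset.mem_Iic.1 hl).trans_lt hkj
        by_cases hli : l = i
        · rw [hli, hxi]; linarith
        · rw [hxl l hli hlj.ne]; exact hmin l hlj
      · have hki : i ≤ k := hij.le.trans hkj
        simp only [hx', Finset.sum_add_distrib, Finset.sum_sub_distrib, Finset.sum_ite_eq',
          Finset.mem_Iic, hkj, hki, if_true]
        linarith [hx k]
    have hsum : ∑ l, |x l| = 2 * t + ∑ l, |x' l| := by
      have habs : ∀ l, |x l| = (if l = i then t else 0) + (if l = j then t else 0) + |x' l| := by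
        intro l
        by_cases hli : l = i
        · subst hli
          rw [hxi, abs_of_pos hi, abs_of_nonneg (by linarith)]
          simp [hne]
        · by_cases hlj : l = j
          · subst hlj
            rw [hxj, abs_of_neg hj, abs_of_nonpos (by linarith)]
            simp [hli]
          · simp [hli, hlj, hxl l hli hlj]
      simp only [habs, Finset.sum_add_distrib, Finset.sum_ite_eq', Finset.mem_univ, if_true]
      ring
    have hdec : x = t • (Pi.single i (1 : ℝ) - Pi.single j 1) + x' := by simp [x']
    rcases hor with h | h
    · exact step t _ x' i ht (hsub i j hij) hdec hsupp hi.ne' (by rw [hxi, h, sub_self]) hpos hsum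
    · exact step t _ x' j ht (hsub i j hij) hdec hsupp hj.ne (by rw [hxj, h]; ring) hpos hsum
  · push Not at hneg
    by_cases hzero : ∃ i, x i ≠ 0
    · obtain ⟨i, hi⟩ := hzero
      let x' : Fin n → ℝ := x - (x i / 2) • (Pi.single i (1 : ℝ) + Pi.single i 1)
      have hx' : ∀ l, x' l = if l = i then 0 else x l := by
        intro l
        simp only [x', Pi.sub_apply, Pi.smul_apply, Pi.add_apply, Pi.single_apply, smul_eq_mul]
        split_ifs with h
        · rw [h]; ring
        · ring
      refine step (x i / 2) _ x' i (by linarith [hneg i]) (hdiag i) (by simp [x']) ?_ hi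
        (by simp [hx']) (fun k => Finset.sum_nonneg fun l _ => ?_) ?_
      · intro l hl; simp [hx', hl]
      · rw [hx']; split_ifs
        · exact le_rfl
        · exact hneg l
      · have habs : ∀ l, |x l| = (if l = i then x i else 0) + |x' l| := by
          intro l
          rw [hx']
          split_ifs with h
          · simp [h, abs_of_nonneg (hneg i)]
          · simp
        simp only [habs, Finset.sum_add_distrib, Finset.sum_ite_eq', Finset.mem_univ, if_true]
        ring
    · push Not at hzero
      have hx0 : x = 0 := funext hzero
      exact ⟨0, h0, by simp [hx0]⟩

/-- The `ℓ¹` ball of any radius is convex. -/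
theorem convex_setOf_sum_abs_le {ι : Type*} [Fintype ι] (r : ℝ) :
    Convex ℝ {x : ι → ℝ | ∑ l, |x l| ≤ r} := by
  intro x hx y hy a b ha hb hab
  simp only [Set.mem_ofPred_eq] at *
  calc ∑ l, |(a • x + b • y) l| ≤ ∑ l, (a * |x l| + b * |y l|) := by
        refine Finset.sum_le_sum fun l _ => ?_
        simp only [Pi.add_apply, Pi.smul_apply, smul_eq_mul]
        refine (abs_add_le _ _).trans_eq ?_
        rw [abs_mul, abs_mul, abs_of_nonneg ha, abs_of_nonneg hb]
    _ = a * ∑ l, |x l| + b * ∑ l, |y l| := by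
        rw [Finset.sum_add_distrib, Finset.mul_sum, Finset.mul_sum]
    _ ≤ a * r + b * r := by gcongr
    _ = r := by rw [← add_mul, hab, one_mul]

/-- Type C_n: the positive root polytope equals the intersection of the root polytope
with the cone of nonnegative combinations of positive roots. -/
theorem typeC_positive_polytope_eq_inter_cone (n : ℕ) (hn : 1 ≤ n)
    (e : Fin n → (Fin n → ℝ))
    (he : ∀ i, e i = fun k => if k = i then (1 : ℝ) else 0)
    (Φ Φpos Cpos : Set (Fin n → ℝ))
    (hΦ : Φ = {v | (∃ i j : Fin n, i < j ∧
          (v = e i + e j ∨ v = e i - e j ∨ v = -e i + e j ∨ v = -e i - e j)) ∨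
        (∃ i : Fin n, v = (2 : ℝ) • e i ∨ v = -((2 : ℝ) • e i))})
    (hΦpos : Φpos = {v | (∃ i j : Fin n, i < j ∧ v = e i - e j) ∨
        (∃ i j : Fin n, i ≤ j ∧ v = e i + e j)})
    (hC : Cpos = {x | ∃ c d : Fin n → Fin n → ℝ,
        (∀ i j, 0 ≤ c i j) ∧ (∀ i j, 0 ≤ d i j) ∧
        x = (∑ i : Fin n, ∑ j : Fin n, (if i < j then c i j • (e i - e j) else 0))
          + (∑ i : Fin n, ∑ j : Fin n, (if i ≤ j then d i j • (e i + e j) else 0))}) :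
    convexHull ℝ (Φpos ∪ {0}) = convexHull ℝ Φ ∩ Cpos := by
  obtain rfl : e = fun i => Pi.single i (1 : ℝ) := by
    funext i k; rw [he, Pi.single_apply]
  clear he
  beta_reduce at hΦ hΦpos hC
  apply Set.Subset.antisymm
  · have hCconv : Convex ℝ Cpos := by
      rw [hC]
      rintro x ⟨c, d, hc, hd, rfl⟩ y ⟨c', d', hc', hd', rfl⟩ a b ha hb -
      refine ⟨fun i j => a * c i j + b * c' i j, fun i j => a * d i j + b * d' i j,
        fun i j => add_nonneg (mul_nonneg ha (hc i j)) (mul_nonneg hb (hc' i j)),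
        fun i j => add_nonneg (mul_nonneg ha (hd i j)) (mul_nonneg hb (hd' i j)), ?_⟩
      rw [smul_add, smul_add, add_add_add_comm]
      simp only [Finset.smul_sum, ← Finset.sum_add_distrib]
      refine Finset.sum_congr rfl fun i _ => Finset.sum_congr rfl fun j _ => ?_
      split_ifs <;> simp only [add_smul, mul_smul, smul_zero, add_zero]
    refine convexHull_min ?_ ((convex_convexHull ℝ Φ).inter hCconv)
    rintro v (hv | rfl)
    · refine ⟨subset_convexHull ℝ Φ ?_, ?_⟩
      · rw [hΦpos] at hv
        rw [hΦ]
        rcases hv with ⟨i, j, hij, rfl⟩ | ⟨i, j, hij, rfl⟩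
        · exact Or.inl ⟨i, j, hij, Or.inr (Or.inl rfl)⟩
        · rcases hij.lt_or_eq with h | rfl
          · exact Or.inl ⟨i, j, h, Or.inl rfl⟩
          · exact Or.inr ⟨i, Or.inl (by rw [two_smul])⟩
      · rw [hΦpos] at hv
        rw [hC]
        have hnn : ∀ i j k l : Fin n, (0 : ℝ) ≤ if k = i then if l = j then 1 else 0 else 0 := by
          intro i j k l; split_ifs <;> norm_num
        rcases hv with ⟨i, j, hij, rfl⟩ | ⟨i, j, hij, rfl⟩
        · refine ⟨fun k l => if k = i then if l = j then 1 else 0 else 0, fun _ _ => 0,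
            hnn i j, fun _ _ => le_rfl, ?_⟩
          rw [Finset.sum_eq_single i, Finset.sum_eq_single j]
          · simp [hij]
          · intro l _ hl; simp [hl]
          · simp
          · intro k _ hk; simp [hk]
          · simp
        · refine ⟨fun _ _ => 0, fun k l => if k = i then if l = j then 1 else 0 else 0,
            fun _ _ => le_rfl, hnn i j, ?_⟩
          simp only [zero_smul, ite_self, Finset.sum_const_zero, zero_add]
          rw [Finset.sum_eq_single i, Finset.sum_eq_single j]
          · simp [hij]
          · intro l _ hl; simp [hl]
          · simp
          · intro k _ hk; simp [hk]
          · simp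
    · constructor
      · let i : Fin n := ⟨0, hn⟩
        have h1 : (2 : ℝ) • Pi.single i (1 : ℝ) ∈ Φ := by
          rw [hΦ]; exact Or.inr ⟨i, Or.inl rfl⟩
        have h2 : -((2 : ℝ) • Pi.single i (1 : ℝ)) ∈ Φ := by
          rw [hΦ]; exact Or.inr ⟨i, Or.inr rfl⟩
        have := (convex_convexHull ℝ Φ) (subset_convexHull ℝ Φ h1) (subset_convexHull ℝ Φ h2)
          (a := 1 / 2) (b := 1 / 2) (by norm_num) (by norm_num) (by norm_num)
        rwa [smul_neg, add_neg_cancel] at this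
      · rw [hC]
        exact ⟨fun _ _ => 0, fun _ _ => 0, fun _ _ => le_rfl, fun _ _ => le_rfl, by simp⟩
  · rintro x ⟨hxΦ, hxC⟩
    have hK := convex_convexHull ℝ (Φpos ∪ {0})
    have h0 : (0 : Fin n → ℝ) ∈ convexHull ℝ (Φpos ∪ {0}) :=
      subset_convexHull ℝ _ (Or.inr rfl)
    have hnorm : ∑ l, |x l| ≤ 2 := by
      refine convexHull_min ?_ (convex_setOf_sum_abs_le 2) hxΦ
      have hsingle : ∀ i : Fin n, ∑ l, |(Pi.single i (1 : ℝ) : Fin n → ℝ) l| = 1 := by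
        intro i
        rw [Finset.sum_eq_single i] <;> simp +contextual
      have hpair : ∀ (a b : ℝ) (i j : Fin n), |a| = 1 → |b| = 1 →
          ∑ l, |(a • Pi.single i (1 : ℝ) + b • Pi.single j (1 : ℝ) : Fin n → ℝ) l| ≤ 2 := by
        intro a b i j ha hb
        calc _ ≤ ∑ l, (|(Pi.single i (1 : ℝ) : Fin n → ℝ) l|
              + |(Pi.single j (1 : ℝ) : Fin n → ℝ) l|) := by
              refine Finset.sum_le_sum fun l _ => ?_
              refine (abs_add_le _ _).trans_eq ?_
              simp only [Pi.smul_apply, smul_eq_mul, abs_mul, ha, hb, one_mul]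
          _ = 2 := by rw [Finset.sum_add_distrib, hsingle, hsingle]; norm_num
      rw [hΦ]
      rintro v (⟨i, j, -, rfl | rfl | rfl | rfl⟩ | ⟨i, rfl | rfl⟩)
      · simpa using hpair 1 1 i j (by simp) (by simp)
      · simpa [sub_eq_add_neg] using hpair 1 (-1) i j (by simp) (by simp)
      · simpa using hpair (-1) 1 i j (by simp) (by simp)
      · simpa [sub_eq_add_neg] using hpair (-1) (-1) i j (by simp) (by simp)
      · have := hpair 1 1 i i (by simp) (by simp)
        rwa [one_smul, ← two_smul ℝ] at this
      · have := hpair (-1) (-1) i i (by simp) (by simp)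
        rwa [neg_one_smul, ← neg_add, ← two_smul ℝ] at this
    have hsums : ∀ k, 0 ≤ ∑ l ∈ Finset.Iic k, x l := by
      intro k
      let L : (Fin n → ℝ) →ₗ[ℝ] ℝ := ∑ l ∈ Finset.Iic k, LinearMap.proj l
      have hL : ∀ y, L y = ∑ l ∈ Finset.Iic k, y l := fun y => by simp [L]
      have hLe : ∀ i, L (Pi.single i 1) = if i ≤ k then 1 else 0 := by
        intro i; simp [hL, Pi.single_apply]
      rw [← hL]
      rw [hC] at hxC
      obtain ⟨c, d, hc, hd, rfl⟩ := hxC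
      simp only [map_add, map_sum]
      refine add_nonneg (Finset.sum_nonneg fun i _ => Finset.sum_nonneg fun j _ => ?_)
        (Finset.sum_nonneg fun i _ => Finset.sum_nonneg fun j _ => ?_)
      · split_ifs with hij
        · rw [map_smul, map_sub, hLe, hLe]
          refine mul_nonneg (hc i j) (sub_nonneg.2 ?_)
          split_ifs with h1 h2
          · exact le_rfl
          · exact absurd (hij.le.trans h1) h2
          · exact zero_le_one
          · exact le_rfl
        · rw [map_zero]
      · split_ifs with hij
        · rw [map_smul, map_add, hLe, hLe]
          refine mul_nonneg (hd i j) (add_nonneg ?_ ?_) <;> split_ifs <;> norm_num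
        · rw [map_zero]
    obtain ⟨y, hy, hyx⟩ := mem_half_sum_abs_smul_of_initial_sums_nonneg hK h0
      (fun i j hij => subset_convexHull ℝ _ (Or.inl (by rw [hΦpos]; exact Or.inl ⟨i, j, hij, rfl⟩)))
      (fun i => subset_convexHull ℝ _ (Or.inl (by rw [hΦpos]; exact Or.inr ⟨i, i, le_rfl, rfl⟩)))
      x hsums
    rw [← hyx]
    exact hK.smul_mem_of_zero_mem h0 hy ⟨by positivity, by linarith⟩
end

section
/- For the type B_3 root system, the equality conv(Φ⁺ ∪ {0}) = conv(Φ) ∩ 𝒞⁺ fails. Explicitly, the point x = (1/2, −1/2, 1) ∈ ℝ^3 (which is half of α_1 + 2α_3, i.e. the midpoint of the roots −(e_2 − e_3) and e_1 + e_3) belongs to conv(Φ) ∩ 𝒞⁺ but does not belong to conv(Φ⁺ ∪ {0}). -/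
/-- Type B_3: the point (1/2, -1/2, 1) lies in conv(Φ) ∩ 𝒞⁺ but not in conv(Φ⁺ ∪ {0}),
so the equality conv(Φ⁺ ∪ {0}) = conv(Φ) ∩ 𝒞⁺ fails in type B_3. -/
theorem typeB3_counterexample
    (e : Fin 3 → (Fin 3 → ℝ))
    (he : ∀ i, e i = fun k => if k = i then (1 : ℝ) else 0)
    (Φ Φpos Cpos : Set (Fin 3 → ℝ))
    (hΦ : Φ = {v | (∃ i : Fin 3, v = e i ∨ v = -e i) ∨
        (∃ i j : Fin 3, i < j ∧
          (v = e i + e j ∨ v = e i - e j ∨ v = -e i + e j ∨ v = -e i - e j))})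
    (hΦpos : Φpos = {v | (∃ i : Fin 3, v = e i) ∨
        (∃ i j : Fin 3, i < j ∧ (v = e i - e j ∨ v = e i + e j))})
    (hC : Cpos = {x | ∃ (c : Fin 3 → ℝ) (d f : Fin 3 → Fin 3 → ℝ),
        (∀ i, 0 ≤ c i) ∧ (∀ i j, 0 ≤ d i j) ∧ (∀ i j, 0 ≤ f i j) ∧
        x = (∑ i : Fin 3, c i • e i)
          + (∑ i : Fin 3, ∑ j : Fin 3, (if i < j then d i j • (e i - e j) else 0))
          + (∑ i : Fin 3, ∑ j : Fin 3, (if i < j then f i j • (e i + e j) else 0))})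
    (x : Fin 3 → ℝ) (hx : x = ![1/2, -1/2, 1]) :
    x ∈ convexHull ℝ Φ ∩ Cpos ∧ x ∉ convexHull ℝ (Φpos ∪ {0}) := by
  subst hx
  have he₀ : e 0 = ![1, 0, 0] := by
    rw [he]
    ext k
    fin_cases k <;> simp
  have he₁ : e 1 = ![0, 1, 0] := by
    rw [he]
    ext k
    fin_cases k <;> simp
  have he₂ : e 2 = ![0, 0, 1] := by
    rw [he]
    ext k
    fin_cases k <;> simp
  refine ⟨⟨?_, ?_⟩, ?_⟩
  · have h₁ : -e 1 + e 2 ∈ Φ := by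
      rw [hΦ]
      exact Or.inr ⟨1, 2, by decide, Or.inr (Or.inr (Or.inl rfl))⟩
    have h₂ : e 0 + e 2 ∈ Φ := by
      rw [hΦ]
      exact Or.inr ⟨0, 2, by decide, Or.inl rfl⟩
    have h := convex_convexHull ℝ Φ (subset_convexHull ℝ Φ h₁) (subset_convexHull ℝ Φ h₂)
      (by norm_num : (0 : ℝ) ≤ 1 / 2) (by norm_num : (0 : ℝ) ≤ 1 / 2) (by norm_num)
    convert h using 1
    ext k
    fin_cases k <;> simp [he₀, he₁, he₂] <;> norm_num
  · rw [hC]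
    refine ⟨fun i => if i = 2 then 1 else 0,
      fun i j => if i = 0 ∧ j = 1 then 1 / 2 else 0, fun _ _ => 0, ?_, ?_, ?_, ?_⟩
    · intro i
      positivity
    · intro i j
      positivity
    · intro i j
      exact le_rfl
    · ext k
      fin_cases k <;> simp [he₀, he₁, he₂, Fin.sum_univ_three] <;> norm_num
  · -- The functional `v ↦ v 2 - v 1` separates the point from `Φpos ∪ {0}`.
    intro h
    have hconv : Convex ℝ {v : Fin 3 → ℝ | v 2 - v 1 ≤ 1} :=
      convex_halfSpace_le
        (LinearMap.proj (R := ℝ) (φ := fun _ : Fin 3 => ℝ) 2 - LinearMap.proj 1).isLinear 1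
    have hsub : Φpos ∪ {0} ⊆ {v : Fin 3 → ℝ | v 2 - v 1 ≤ 1} := by
      rw [hΦpos]
      rintro v ((⟨i, rfl⟩ | ⟨i, j, hij, rfl | rfl⟩) | rfl)
      · fin_cases i <;> simp [he₀, he₁, he₂]
      · fin_cases i <;> fin_cases j <;> simp [he₀, he₁, he₂] at hij ⊢ <;> norm_num
      · fin_cases i <;> fin_cases j <;> simp [he₀, he₁, he₂] at hij ⊢
      · norm_num
    have hle := convexHull_min hsub hconv h
    simp only [Set.mem_ofPred_eq, Matrix.cons_val] at hle
    norm_num at hle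
end

section
/- Let n ≥ 1 and let Φ be the type A_n root system in ℝ^{n+1}. Every ℝ-linearly independent subset B ⊆ Φ with |B| = n is a ℤ-basis of the root lattice: the set of integer linear combinations of the elements of B is exactly {x ∈ ℤ^{n+1} : x_1 + ⋯ + x_{n+1} = 0}. -/
/-- Linearly independent vectors whose coordinates sum to zero, one fewer than the dimension, span
the hyperplane of all vectors with coordinate sum zero. -/
theorem mem_span_of_sum_eq_zero {n : ℕ} (B : Finset (Fin (n+1) → ℝ)) (hcard : B.card = n)
    (hind : LinearIndependent ℝ (fun b : {x // x ∈ B} => b.val))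
    (hsum : ∀ b ∈ B, ∑ i, b i = 0) {x : Fin (n+1) → ℝ} (hx : ∑ i, x i = 0) :
    x ∈ Submodule.span ℝ (B : Set (Fin (n+1) → ℝ)) := by
  set g : (Fin (n+1) → ℝ) →ₗ[ℝ] ℝ := ∑ i, LinearMap.proj i with hg
  have hgx : ∀ y, g y = ∑ i, y i := fun y => by simp [hg, LinearMap.sum_apply]
  have hle : Submodule.span ℝ (B : Set (Fin (n+1) → ℝ)) ≤ LinearMap.ker g :=
    Submodule.span_le.2 fun b hb => by
      rw [SetLike.mem_coe, LinearMap.mem_ker, hgx]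
      exact hsum b hb
  have hlt : Module.finrank ℝ (LinearMap.ker g) < n + 1 := by
    have htop : LinearMap.ker g ≠ ⊤ := fun h => by
      have h1 : (Pi.single 0 1 : Fin (n+1) → ℝ) ∈ LinearMap.ker g := h ▸ Submodule.mem_top
      rw [LinearMap.mem_ker, hgx] at h1
      simp at h1
    simpa using Submodule.finrank_lt htop
  have hfin : Module.finrank ℝ (Submodule.span ℝ (B : Set (Fin (n+1) → ℝ))) = n := by
    rw [finrank_span_finset_eq_card hind, hcard]
  rw [Submodule.eq_of_le_of_finrank_le hle (by omega), LinearMap.mem_ker, hgx]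
  exact hx


/-- Type A_n: every linearly independent set of n roots is a ℤ-basis of the root lattice. -/
theorem typeA_independent_roots_span_root_lattice (n : ℕ) (hn : 1 ≤ n)
    (e : Fin (n+1) → (Fin (n+1) → ℝ))
    (he : ∀ i, e i = fun k => if k = i then (1 : ℝ) else 0)
    (Φ : Set (Fin (n+1) → ℝ))
    (hΦ : Φ = {v | ∃ i j : Fin (n+1), i ≠ j ∧ v = e i - e j})
    (B : Finset (Fin (n+1) → ℝ)) (hBΦ : ↑B ⊆ Φ)
    (hBcard : B.card = n)
    (hBind : LinearIndependent ℝ (fun b : {x // x ∈ B} => b.val)) :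
    (Submodule.span ℤ (B : Set (Fin (n+1) → ℝ)) : Set (Fin (n+1) → ℝ))
      = {x | (∀ i, ∃ m : ℤ, x i = (m : ℝ)) ∧ ∑ i, x i = 0} := by
  classical
  have hes : ∀ i, e i = Pi.single i 1 := fun i => by
    rw [he i]; ext k; simp [Pi.single_apply]
  have hroot : ∀ b ∈ B, ∃ i j, b = e i - e j := fun b hb => by
    have h := hBΦ hb
    rw [hΦ] at h
    obtain ⟨i, j, -, h⟩ := h
    exact ⟨i, j, h⟩
  have hsum : ∀ i j, ∑ k, (e i - e j) k = 0 := fun i j => by simp [hes]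
  set L := Submodule.span ℤ (B : Set (Fin (n+1) → ℝ))
  have hmem : ∀ i, e i - e 0 ∈ L := by
    intro j
    by_contra hj
    let f : (Fin (n+1) → ℝ) →ₗ[ℝ] ℝ :=
      ∑ i, (if e i - e 0 ∈ L then (1 : ℝ) else 0) • LinearMap.proj i
    have hfe : ∀ i, f (e i) = if e i - e 0 ∈ L then 1 else 0 := fun i => by
      simp only [f, LinearMap.sum_apply, LinearMap.smul_apply, LinearMap.proj_apply]
      rw [Finset.sum_eq_single i (fun k _ hk => by simp [he i, hk]) (by simp)]
      simp [show e i i = 1 by simp [he i]]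
    have hle : Submodule.span ℝ (B : Set (Fin (n+1) → ℝ)) ≤ LinearMap.ker f := by
      refine Submodule.span_le.2 fun b hb => ?_
      obtain ⟨i, k, rfl⟩ := hroot b hb
      have hik : e i - e k ∈ L := Submodule.subset_span hb
      have hiff : e i - e 0 ∈ L ↔ e k - e 0 ∈ L := by
        rw [← sub_add_sub_cancel (e i) (e k) (e 0)]
        exact L.add_mem_iff_right hik
      rw [SetLike.mem_coe, LinearMap.mem_ker, map_sub, hfe, hfe]
      simp only [hiff, sub_self]
    have hker := hle (mem_span_of_sum_eq_zero B hBcard hBind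
      (fun b hb => by obtain ⟨i, k, rfl⟩ := hroot b hb; exact hsum i k) (hsum j 0))
    rw [LinearMap.mem_ker, map_sub, hfe, hfe, if_neg hj, sub_self, if_pos L.zero_mem] at hker
    norm_num at hker
  ext x
  constructor
  · intro hx
    refine Submodule.span_induction (p := fun x _ =>
      (∀ i, ∃ m : ℤ, x i = (m : ℝ)) ∧ ∑ i, x i = 0) ?_ ?_ ?_ ?_ hx
    · intro b hb
      obtain ⟨i, j, rfl⟩ := hroot b hb
      refine ⟨fun k => ⟨(if k = i then 1 else 0) - (if k = j then 1 else 0), ?_⟩, hsum i j⟩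
      simp [he]
    · exact ⟨fun _ => ⟨0, by simp⟩, by simp⟩
    · rintro x y - - ⟨hx, hx0⟩ ⟨hy, hy0⟩
      refine ⟨fun i => ?_, by simp [Finset.sum_add_distrib, hx0, hy0]⟩
      obtain ⟨a, ha⟩ := hx i
      obtain ⟨b, hb⟩ := hy i
      exact ⟨a + b, by simp [ha, hb]⟩
    · rintro c x - ⟨hx, hx0⟩
      refine ⟨fun i => ?_, by simp [← Finset.mul_sum, hx0]⟩
      obtain ⟨a, ha⟩ := hx i
      exact ⟨c * a, by simp [ha]⟩
  · rintro ⟨hint, h0⟩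
    choose m hm using hint
    have hx : x = ∑ i, m i • (e i - e 0) := by
      have hm0 : ∑ i, (m i : ℝ) = 0 := by simpa only [hm] using h0
      ext k
      simp [he, Finset.sum_apply, mul_sub, Finset.sum_sub_distrib, hm0, hm]
    rw [hx]
    exact L.sum_mem fun i _ => L.smul_mem _ (hmem i)
end

section
/- Let n ≥ 1 and consider the type C_n setting in ℝ^n. Let (a_1,b_1), …, (a_n,b_n) be a staircase path, i.e. (a_1,b_1) = (1,n) and for each k ∈ [n−1], (a_{k+1}, b_{k+1}) equals (a_k + 1, b_k) or (a_k, b_k − 1). Then the root set B = {e_{a_k} + e_{b_k} : k ∈ [n]} consists of n linearly independent vectors and is a ℤ-basis of the root lattice of C_n: the ℤ-span of B equals {x ∈ ℤ^n : x_1 + ⋯ + x_n is even}. -/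
/-- The `a`-th standard basis vector of `ℝ^n`, with 1-based index `a`. -/
noncomputable def stdC (n : ℕ) (a : ℕ) : Fin n → ℝ := fun j => if (j : ℕ) + 1 = a then 1 else 0

/-- Along a staircase path the index pairs stay in `[1, n]`, and the gap `b k - a k` is `n - k`. -/
theorem staircase_bounds {n : ℕ} {a b : ℕ → ℕ} (ha1 : a 1 = 1) (hb1 : b 1 = n)
    (hstep : ∀ k, 1 ≤ k → k + 1 ≤ n →
      (a (k+1) = a k + 1 ∧ b (k+1) = b k) ∨ (a (k+1) = a k ∧ b k = b (k+1) + 1))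
    {k : ℕ} (hk : 1 ≤ k) (hkn : k ≤ n) :
    1 ≤ a k ∧ b k ≤ n ∧ a k + n = b k + k := by
  induction k, hk using Nat.le_induction with
  | base => omega
  | succ k hk ih =>
    have := ih (by omega)
    have := hstep k hk hkn
    omega

/-- An additive subgroup containing the roots `e_{a k} + e_{b k}` of a staircase path contains
`e_i + e_j` for all `i, j` in the interval `[a k, b k]`. -/
theorem staircase_add_mem {M : Type*} [AddCommGroup M] (e : ℕ → M) (S : AddSubgroup M)
    {n : ℕ} {a b : ℕ → ℕ} (ha1 : a 1 = 1) (hb1 : b 1 = n)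
    (hstep : ∀ k, 1 ≤ k → k + 1 ≤ n →
      (a (k+1) = a k + 1 ∧ b (k+1) = b k) ∨ (a (k+1) = a k ∧ b k = b (k+1) + 1))
    (hS : ∀ k, 1 ≤ k → k ≤ n → e (a k) + e (b k) ∈ S) {k : ℕ} (hk : 1 ≤ k) (hkn : k ≤ n) :
    ∀ i j, a k ≤ i → i ≤ b k → a k ≤ j → j ≤ b k → e i + e j ∈ S := by
  have extend : ∀ (c d : ℕ) (I : Set ℕ), e c + e d ∈ S → d ∈ I →
      (∀ i ∈ I, ∀ j ∈ I, e i + e j ∈ S) →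
      ∀ i j, (i = c ∨ i ∈ I) → (j = c ∨ j ∈ I) → e i + e j ∈ S := by
    intro c d I hcd hd hI
    have hc : ∀ i ∈ I, e c + e i ∈ S := fun i hi => by
      have := S.sub_mem (S.add_mem hcd (hI i hi d hd)) (hI d hd d hd)
      convert this using 1
      abel
    rintro i j (rfl | hi) (rfl | hj)
    · have := S.sub_mem (S.add_mem hcd hcd) (hI d hd d hd)
      convert this using 1
      abel
    · exact hc j hj
    · rw [add_comm]
      exact hc i hi
    · exact hI i hi j hj
  induction hkn using Nat.decreasingInduction with
  | self =>
    intro i j hi hi' hj hj'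
    have := staircase_bounds ha1 hb1 hstep hk le_rfl
    obtain rfl : i = a n := by omega
    obtain rfl : j = b n := by omega
    exact hS n hk le_rfl
  | of_succ k hkn ih =>
    have hb := staircase_bounds ha1 hb1 hstep (k := k + 1) (by omega) hkn
    have hv := hS k hk (by omega)
    have hI : ∀ i ∈ Set.Icc (a (k+1)) (b (k+1)), ∀ j ∈ Set.Icc (a (k+1)) (b (k+1)),
        e i + e j ∈ S := fun i hi j hj => ih (by omega) i j hi.1 hi.2 hj.1 hj.2
    intro i j hi hi' hj hj'
    rcases hstep k hk hkn with ⟨h1, h2⟩ | ⟨h1, h2⟩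
    · refine extend (a k) (b k) _ hv ?_ hI i j ?_ ?_ <;> simp only [Set.mem_Icc] <;> omega
    · rw [add_comm] at hv
      refine extend (b k) (a k) _ hv ?_ hI i j ?_ ?_ <;> simp only [Set.mem_Icc] <;> omega

theorem stdC_succ (n : ℕ) (i : Fin n) : stdC n ((i : ℕ) + 1) = Pi.single i 1 := by
  ext j
  simp [stdC, Pi.single_apply, Fin.ext_iff]

/-- The root lattice of type `C_n`: integer vectors with even coordinate sum. -/
def rootLatticeC (n : ℕ) : AddSubgroup (Fin n → ℝ) where
  carrier := {x | (∀ i, ∃ m : ℤ, x i = (m : ℝ)) ∧ ∃ m : ℤ, ∑ i, x i = 2 * (m : ℝ)}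
  zero_mem' := ⟨fun _ => ⟨0, by simp⟩, 0, by simp⟩
  add_mem' := by
    rintro x y ⟨hx, m, hm⟩ ⟨hy, l, hl⟩
    refine ⟨fun i => ?_, m + l, ?_⟩
    · obtain ⟨p, hp⟩ := hx i
      obtain ⟨q, hq⟩ := hy i
      exact ⟨p + q, by simp [hp, hq]⟩
    · simp only [Pi.add_apply, Finset.sum_add_distrib, hm, hl]
      push_cast
      ring
  neg_mem' := by
    rintro x ⟨hx, m, hm⟩
    refine ⟨fun i => ?_, -m, ?_⟩
    · obtain ⟨p, hp⟩ := hx i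
      exact ⟨-p, by simp [hp]⟩
    · simp [hm]

theorem stdC_add_stdC_mem_rootLatticeC {n c d : ℕ} (hc : 1 ≤ c) (hcn : c ≤ n) (hd : 1 ≤ d)
    (hdn : d ≤ n) : stdC n c + stdC n d ∈ rootLatticeC n := by
  obtain ⟨i, rfl⟩ : ∃ i : Fin n, c = i + 1 := ⟨⟨c - 1, by omega⟩, by simp; omega⟩
  obtain ⟨j, rfl⟩ : ∃ j : Fin n, d = j + 1 := ⟨⟨d - 1, by omega⟩, by simp; omega⟩
  refine ⟨fun k => ⟨(if (k : ℕ) + 1 = i + 1 then 1 else 0) +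
    (if (k : ℕ) + 1 = j + 1 then 1 else 0), by simp [stdC]⟩, 1, ?_⟩
  simp only [stdC_succ, Pi.add_apply, Finset.sum_add_distrib, Finset.sum_pi_single',
    Finset.mem_univ, if_true]
  norm_num

/-- An additive subgroup containing all `e_i + e_j` contains the root lattice of type `C_n`. -/
theorem rootLatticeC_le {n : ℕ} (hn : 1 ≤ n) {S : AddSubgroup (Fin n → ℝ)}
    (hS : ∀ i j, 1 ≤ i → i ≤ n → 1 ≤ j → j ≤ n → stdC n i + stdC n j ∈ S) :
    rootLatticeC n ≤ S := by
  rintro x ⟨hx, m, hm⟩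
  choose f hf using hx
  have hx' : x = ∑ i : Fin n, f i • (stdC n ((i : ℕ) + 1) + stdC n 1)
      - m • (stdC n 1 + stdC n 1) := by
    have h1 : ∑ i : Fin n, f i • stdC n ((i : ℕ) + 1) = x := by
      ext j
      simp [stdC_succ, Pi.single_apply, hf]
    have h2 : ∑ i, f i = 2 * m := by
      simp only [hf] at hm
      exact_mod_cast hm
    simp only [smul_add, Finset.sum_add_distrib, h1, ← Finset.sum_smul, h2]
    module
  rw [hx']
  exact S.sub_mem
    (S.sum_mem fun i _ => S.zsmul_mem (hS _ _ (by omega) (by omega) le_rfl hn) _)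
    (S.zsmul_mem (hS _ _ le_rfl hn le_rfl hn) _)

/-- Type C_n: the root set of a staircase path from α_{1,n} to a long root consists of
n linearly independent vectors and is a ℤ-basis of the root lattice of C_n. -/
theorem typeC_staircase_basis_of_root_lattice (n : ℕ) (hn : 1 ≤ n)
    (a b : ℕ → ℕ)
    (ha1 : a 1 = 1) (hb1 : b 1 = n)
    (hstep : ∀ k, 1 ≤ k → k + 1 ≤ n →
      (a (k+1) = a k + 1 ∧ b (k+1) = b k) ∨ (a (k+1) = a k ∧ b k = b (k+1) + 1))
    (B : Set (Fin n → ℝ))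
    (hB : B = {v | ∃ k, 1 ≤ k ∧ k ≤ n ∧ v = stdC n (a k) + stdC n (b k)}) :
    LinearIndependent ℝ (fun k : Fin n => stdC n (a ((k : ℕ) + 1)) + stdC n (b ((k : ℕ) + 1))) ∧
    (Submodule.span ℤ B : Set (Fin n → ℝ))
      = {x | (∀ i, ∃ m : ℤ, x i = (m : ℝ)) ∧ ∃ m : ℤ, ∑ i, x i = 2 * (m : ℝ)} := by
  have key : ∀ S : AddSubgroup (Fin n → ℝ),
      (∀ k, 1 ≤ k → k ≤ n → stdC n (a k) + stdC n (b k) ∈ S) →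
      ∀ i j, 1 ≤ i → i ≤ n → 1 ≤ j → j ≤ n → stdC n i + stdC n j ∈ S := by
    intro S hS
    have := staircase_add_mem (stdC n) S ha1 hb1 hstep hS le_rfl hn
    rw [ha1, hb1] at this
    exact fun i j hi hi' hj hj' => this i j hi hi' hj hj'
  constructor
  · refine linearIndependent_of_top_le_span_of_card_eq_finrank ?_ (by simp)
    set S := Submodule.span ℝ (Set.range
      fun k : Fin n => stdC n (a ((k : ℕ) + 1)) + stdC n (b ((k : ℕ) + 1))) with hSdef
    have hS := key S.toAddSubgroup fun k hk hkn =>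
      Submodule.subset_span ⟨⟨k - 1, by omega⟩, by simp [Nat.sub_add_cancel hk]⟩
    rw [← (Pi.basisFun ℝ (Fin n)).span_eq, Submodule.span_le]
    rintro _ ⟨i, rfl⟩
    have h2 := S.smul_mem (1 / 2 : ℝ)
      (hS (i + 1) (i + 1) (by omega) (by omega) (by omega) (by omega))
    rw [Pi.basisFun_apply, ← stdC_succ]
    rw [SetLike.mem_coe]
    convert h2 using 1
    module
  · change _ = (rootLatticeC n : Set (Fin n → ℝ))
    apply Set.Subset.antisymm
    · refine (Submodule.span_le (p := (rootLatticeC n).toIntSubmodule)).2 ?_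
      rw [hB]
      rintro _ ⟨k, hk, hkn, rfl⟩
      have := staircase_bounds ha1 hb1 hstep hk hkn
      exact stdC_add_stdC_mem_rootLatticeC (by omega) (by omega) (by omega) (by omega)
    · refine rootLatticeC_le hn (S := (Submodule.span ℤ B).toAddSubgroup) (key _ ?_)
      intro k hk hkn
      exact Submodule.subset_span (hB ▸ ⟨k, hk, hkn, rfl⟩)
end

section
/- Let n ≥ 1, let Φ be the type A_n root system in ℝ^{n+1}, and let S be a nonempty proper subset of {1, …, n+1}. Then conv(Φ) ∩ {x ∈ ℝ^{n+1} : x_s ≥ 0 for all s ∈ S and x_t ≤ 0 for all t ∉ S} = conv({0} ∪ {e_s − e_t : s ∈ S, t ∉ S}). (This expresses that in type A the cones on the facets of the root polytope are exactly the closed regions of the arrangement of coordinate hyperplanes restricted to the span of Φ.) -/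
/-- A vector of coordinate sum zero, nonnegative on `F` and nonpositive off `F`, whose positive part
has mass at most one, is a convex combination of `0` and the differences `e s - e t` with `s ∈ F`
and `t ∉ F`. -/
theorem mem_convexHull_insert_zero_of_sum_le_one {ι : Type*} [Fintype ι] [DecidableEq ι]
    (F : Finset ι) (x : ι → ℝ) (hpos : ∀ s ∈ F, 0 ≤ x s) (hneg : ∀ t ∉ F, x t ≤ 0)
    (hsum : ∑ i, x i = 0) (hle : ∑ i ∈ F, x i ≤ 1) :
    x ∈ convexHull ℝ ({0} ∪ {v : ι → ℝ | ∃ s ∈ F, ∃ t ∉ F,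
      v = Pi.single s (1 : ℝ) - Pi.single t (1 : ℝ)}) := by
  set C := {v : ι → ℝ | ∃ s ∈ F, ∃ t ∉ F, v = Pi.single s (1 : ℝ) - Pi.single t (1 : ℝ)}
  set p := ∑ i ∈ F, x i
  have hcompl : ∑ i ∈ Fᶜ, -x i = p := by
    rw [Finset.sum_neg_distrib]
    linarith [Finset.sum_add_sum_compl F x]
  have hneg' : ∀ t ∈ Fᶜ, 0 ≤ -x t := fun t ht => by
    linarith [hneg t (Finset.mem_compl.1 ht)]
  have hzero : (0 : ι → ℝ) ∈ convexHull ℝ ({0} ∪ C) := subset_convexHull ℝ _ (Or.inl rfl)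
  rcases (Finset.sum_nonneg hpos).eq_or_lt with h0 | (hp0 : 0 < p)
  · have hx : x = 0 := by
      funext i
      by_cases hi : i ∈ F
      · exact (Finset.sum_eq_zero_iff_of_nonneg hpos).1 h0.symm i hi
      · have := (Finset.sum_eq_zero_iff_of_nonneg hneg').1 (hcompl.trans h0.symm) i
          (Finset.mem_compl.2 hi)
        simpa using this
    rwa [hx]
  · have ha : ∑ i ∈ F, (x i / p) • (Pi.single i 1 : ι → ℝ) ∈
        convexHull ℝ ((fun i => (Pi.single i 1 : ι → ℝ)) '' (F : Set ι)) := by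
      refine (convex_convexHull ℝ _).sum_mem (fun i hi => div_nonneg (hpos i hi) hp0.le) ?_
        fun i hi => subset_convexHull ℝ _ ⟨i, hi, rfl⟩
      rw [← Finset.sum_div, div_self hp0.ne']
    have hb : ∑ i ∈ Fᶜ, (-x i / p) • (Pi.single i 1 : ι → ℝ) ∈
        convexHull ℝ ((fun i => (Pi.single i 1 : ι → ℝ)) '' ((Fᶜ : Finset ι) : Set ι)) := by
      refine (convex_convexHull ℝ _).sum_mem (fun i hi => div_nonneg (hneg' i hi) hp0.le) ?_
        fun i hi => subset_convexHull ℝ _ ⟨i, hi, rfl⟩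
      rw [← Finset.sum_div, hcompl, div_self hp0.ne']
    have hab := Set.sub_mem_sub ha hb
    rw [← convexHull_sub] at hab
    have hsub := convexHull_mono (𝕜 := ℝ) (t := {0} ∪ C) (by
      rintro _ ⟨_, ⟨s, hs, rfl⟩, _, ⟨t, ht, rfl⟩, rfl⟩
      exact Or.inr ⟨s, hs, t, by simpa using ht, rfl⟩) hab
    have hx : x = p • (∑ i ∈ F, (x i / p) • (Pi.single i 1 : ι → ℝ) -
        ∑ i ∈ Fᶜ, (-x i / p) • (Pi.single i 1 : ι → ℝ)) := by
      simp only [neg_div, neg_smul, Finset.sum_neg_distrib, sub_neg_eq_add,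
        Finset.sum_add_sum_compl, Finset.smul_sum, smul_smul, mul_div_cancel₀ _ hp0.ne']
      rw [← pi_eq_sum_univ' x]
    rw [hx]
    exact (convex_convexHull ℝ _).smul_mem_of_zero_mem hzero hsub ⟨hp0.le, hle⟩

/-- On the convex hull of the differences `e i - e j`, the coordinate sum vanishes and every partial
coordinate sum is at most one. -/
theorem sum_eq_zero_and_sum_le_one_of_mem_convexHull {ι : Type*} [Fintype ι] [DecidableEq ι]
    (F : Finset ι) {x : ι → ℝ}
    (hx : x ∈ convexHull ℝ {v : ι → ℝ | ∃ i j, i ≠ j ∧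
      v = Pi.single i (1 : ℝ) - Pi.single j (1 : ℝ)}) :
    ∑ i, x i = 0 ∧ ∑ i ∈ F, x i ≤ 1 := by
  refine convexHull_min (t := {x : ι → ℝ | ∑ i, x i = 0 ∧ ∑ i ∈ F, x i ≤ 1}) ?_ ?_ hx
  · rintro _ ⟨i, j, -, rfl⟩
    simp only [Set.mem_ofPred_eq, Pi.sub_apply, Finset.sum_sub_distrib, Finset.sum_pi_single',
      Finset.mem_univ, if_true, sub_self, true_and]
    split_ifs <;> norm_num
  · rintro y ⟨hy0, hy1⟩ z ⟨hz0, hz1⟩ a b ha hb hab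
    simp only [Set.mem_ofPred_eq, Pi.add_apply, Pi.smul_apply, smul_eq_mul,
      Finset.sum_add_distrib, ← Finset.mul_sum, hy0, hz0]
    exact ⟨by simp, by nlinarith⟩

/-- Type A_n: the intersection of the root polytope with the closed region of the
coordinate hyperplane arrangement determined by a nonempty proper subset S of coordinates
is the cone (inside the polytope) on the facet conv{e_s − e_t : s ∈ S, t ∉ S}. -/
theorem typeA_facet_cones_are_regions (n : ℕ) (hn : 1 ≤ n)
    (e : Fin (n+1) → (Fin (n+1) → ℝ))
    (he : ∀ i, e i = fun k => if k = i then (1 : ℝ) else 0)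
    (Φ : Set (Fin (n+1) → ℝ))
    (hΦ : Φ = {v | ∃ i j : Fin (n+1), i ≠ j ∧ v = e i - e j})
    (S : Set (Fin (n+1))) (hS1 : S.Nonempty) (hS2 : S ≠ Set.univ) :
    convexHull ℝ Φ ∩ {x | (∀ s ∈ S, 0 ≤ x s) ∧ (∀ t ∉ S, x t ≤ 0)}
      = convexHull ℝ ({0} ∪ {v | ∃ s ∈ S, ∃ t ∉ S, v = e s - e t}) := by
  classical
  obtain rfl : e = fun i => Pi.single i 1 := by
    funext i k
    simp [he, Pi.single_apply]
  subst hΦ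
  apply Set.Subset.antisymm
  · rintro x ⟨hx, hpos, hneg⟩
    obtain ⟨hsum, hle⟩ := sum_eq_zero_and_sum_le_one_of_mem_convexHull S.toFinset hx
    simpa using mem_convexHull_insert_zero_of_sum_le_one S.toFinset x
      (by simpa using hpos) (by simpa using hneg) hsum hle
  · refine convexHull_min ?_ ((convex_convexHull ℝ _).inter ?_)
    · rintro v (rfl | ⟨s, hs, t, ht, rfl⟩)
      · refine ⟨?_, by simp⟩
        obtain ⟨s, hs⟩ := hS1
        obtain ⟨t, ht⟩ := (Set.ne_univ_iff_exists_notMem S).1 hS2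
        have hst : s ≠ t := fun h => ht (h ▸ hs)
        have hmem := (convex_convexHull ℝ _).midpoint_mem
          (subset_convexHull ℝ {v : Fin (n+1) → ℝ | ∃ i j : Fin (n+1), i ≠ j ∧
            v = Pi.single i 1 - Pi.single j 1} ⟨s, t, hst, rfl⟩)
          (subset_convexHull ℝ _ ⟨t, s, hst.symm, rfl⟩)
        simpa [midpoint_eq_smul_add] using hmem
      · have hst : s ≠ t := fun h => ht (h ▸ hs)
        refine ⟨subset_convexHull ℝ _ ⟨s, t, hst, rfl⟩, fun k hk => ?_, fun k hk => ?_⟩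
        · have hkt : k ≠ t := fun h => ht (h ▸ hk)
          simp only [Pi.sub_apply, Pi.single_apply, hkt, if_false, sub_zero]
          positivity
        · have hks : k ≠ s := fun h => hk (h ▸ hs)
          simp only [Pi.sub_apply, Pi.single_apply, hks, if_false, zero_sub, neg_nonpos]
          positivity
    · rintro y ⟨hy0, hy1⟩ z ⟨hz0, hz1⟩ a b ha hb -
      refine ⟨fun k hk => ?_, fun k hk => ?_⟩
      · exact add_nonneg (mul_nonneg ha (hy0 k hk)) (mul_nonneg hb (hz0 k hk))
      · exact add_nonpos (mul_nonpos_of_nonneg_of_nonpos ha (hy1 k hk))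
          (mul_nonpos_of_nonneg_of_nonpos hb (hz1 k hk))
end

section
/- Let n ≥ 1, fix i ∈ [n], and consider the type A_n setting in ℝ^{n+1}. Set M_i = {e_a − e_b : 1 ≤ a ≤ i < b ≤ n+1}. For a subset N ⊆ M_i, the set M_i \ N is a dual order ideal of Φ⁺ if and only if there exists a permutation w of {1, …, n+1} that is strictly increasing on {1, …, i} and strictly increasing on {i+1, …, n+1}, such that N = {e_a − e_b : 1 ≤ a ≤ i < b ≤ n+1 and w(a) > w(b)}. (This is the type A_n instance of the characterization of the abelian ideals contained in M_i via minimal coset representatives and their inversion sets.) -/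
/-- A strict total order on `Fin m` is the pullback of `<` along a permutation. -/
theorem Fin.exists_perm_lt_iff {m : ℕ} (r : Fin m → Fin m → Prop)
    (irrefl : ∀ x, ¬ r x x) (trans : ∀ x y z, r x y → r y z → r x z)
    (total : ∀ x y, x ≠ y → r x y ∨ r y x) :
    ∃ w : Equiv.Perm (Fin m), ∀ x y, w x < w y ↔ r x y := by
  classical
  have card_lt : ∀ x, (Finset.univ.filter fun z => r z x).card < m := by
    intro x
    have h : (Finset.univ.filter fun z => r z x) ⊂ Finset.univ :=
      Finset.filter_ssubset.2 ⟨x, Finset.mem_univ x, irrefl x⟩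
    simpa using Finset.card_lt_card h
  let f : Fin m → Fin m := fun x => ⟨_, card_lt x⟩
  have mono : ∀ x y, r x y → f x < f y := by
    intro x y hxy
    refine Fin.mk_lt_mk.2 (Finset.card_lt_card ?_)
    refine (Finset.ssubset_iff_of_subset ?_).2 ⟨x, by simpa using hxy, by simpa using irrefl x⟩
    intro z hz
    simp only [Finset.mem_filter, Finset.mem_univ, true_and] at hz ⊢
    exact trans z x y hz hxy
  have inj : Function.Injective f := by
    intro x y hxy
    by_contra hne
    rcases total x y hne with h | h
    · exact (mono x y h).ne hxy
    · exact (mono y x h).ne hxy.symm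
  refine ⟨Equiv.ofBijective f (Finite.injective_iff_bijective.1 inj), fun x y => ⟨?_, mono x y⟩⟩
  intro hlt
  have hlt' : f x < f y := hlt
  by_contra hr
  rcases eq_or_ne x y with rfl | hne
  · exact lt_irrefl _ hlt'
  · exact lt_asymm hlt' (mono y x ((total x y hne).resolve_left hr))

theorem sum_Iic_single_sub_single {n : ℕ} (m a b : Fin (n + 1)) :
    ∑ k ∈ Finset.Iic m, ((Pi.single a 1 - Pi.single b 1 : Fin (n + 1) → ℝ) k) =
      (if a ≤ m then 1 else 0) - (if b ≤ m then 1 else 0) := by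
  simp [Pi.single_apply, Finset.sum_sub_distrib]

theorem single_sub_single_eq_sum_simple {n : ℕ} {a b : Fin (n + 1)} (hab : a ≤ b) :
    ∃ c : Fin n → ℕ, (Pi.single a 1 - Pi.single b 1 : Fin (n + 1) → ℝ) =
      ∑ k : Fin n, (c k : ℝ) • (Pi.single k.castSucc 1 - Pi.single k.succ 1) := by
  induction b using Fin.induction with
  | zero =>
    obtain rfl : a = 0 := Fin.le_zero_iff.1 hab
    exact ⟨0, by simp⟩
  | succ j ih =>
    rcases hab.eq_or_lt with rfl | hlt
    · exact ⟨0, by simp⟩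
    · obtain ⟨c, hc⟩ := ih (Fin.le_castSucc_iff.2 hlt)
      refine ⟨c + Pi.single j 1, ?_⟩
      have hj : ∑ k : Fin n, ((Pi.single j 1 : Fin n → ℕ) k : ℝ) •
          (Pi.single k.castSucc 1 - Pi.single k.succ 1 : Fin (n + 1) → ℝ) =
          Pi.single j.castSucc 1 - Pi.single j.succ 1 := by
        rw [Finset.sum_eq_single j]
        · simp
        · intro k _ hk
          simp [hk]
        · simp
      simp only [Pi.add_apply, Nat.cast_add, add_smul, Finset.sum_add_distrib]
      rw [hj, ← hc]
      abel

/-- The root order in type A: `e a - e b ≤ e a' - e b'` iff `[a, b] ⊆ [a', b']`. -/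
theorem positive_root_le_iff {n : ℕ} {a b a' b' : Fin (n + 1)} (hab : a < b) :
    (∃ c : Fin n → ℕ, (Pi.single a' 1 - Pi.single b' 1 : Fin (n + 1) → ℝ)
        - (Pi.single a 1 - Pi.single b 1) =
      ∑ k : Fin n, (c k : ℝ) • (Pi.single k.castSucc 1 - Pi.single k.succ 1)) ↔
      a' ≤ a ∧ b ≤ b' := by
  constructor
  · rintro ⟨c, hc⟩
    have key : ∀ m : Fin (n + 1),
        (if a ≤ m then (1 : ℝ) else 0) - (if b ≤ m then 1 else 0) ≤
          (if a' ≤ m then 1 else 0) - (if b' ≤ m then 1 else 0) := by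
      intro m
      rw [← sum_Iic_single_sub_single, ← sum_Iic_single_sub_single, ← sub_nonneg,
        ← Finset.sum_sub_distrib]
      refine le_of_le_of_eq ?_ (Finset.sum_congr rfl fun x _ => (congrFun hc x).symm)
      simp only [Finset.sum_apply, Pi.smul_apply, smul_eq_mul]
      rw [Finset.sum_comm]
      refine Finset.sum_nonneg fun k _ => ?_
      rw [← Finset.mul_sum, sum_Iic_single_sub_single]
      refine mul_nonneg (Nat.cast_nonneg _) ?_
      have : k.succ ≤ m → k.castSucc ≤ m := (Fin.castSucc_lt_succ).le.trans
      split_ifs <;> simp_all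
    have ha := key a
    rw [if_pos le_rfl, if_neg hab.not_ge] at ha
    have haa : a' ≤ a ∧ a < b' := by
      split_ifs at ha with h1 h2 h2 <;> first | exact ⟨h1, not_le.1 h2⟩ | norm_num at ha
    refine ⟨haa.1, ?_⟩
    by_contra hb
    have hb' := key b'
    rw [if_pos haa.2.le, if_neg hb, if_pos le_rfl] at hb'
    split_ifs at hb' <;> norm_num at hb'
  · rintro ⟨ha, hb⟩
    obtain ⟨c, hc⟩ := single_sub_single_eq_sum_simple ha
    obtain ⟨d, hd⟩ := single_sub_single_eq_sum_simple hb
    refine ⟨c + d, ?_⟩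
    simp only [Pi.add_apply, Nat.cast_add, add_smul, Finset.sum_add_distrib]
    rw [← hc, ← hd]
    abel

theorem positive_root_inj {n : ℕ} {a b a' b' : Fin (n + 1)} (hab : a < b) (hab' : a' < b')
    (h : (Pi.single a 1 - Pi.single b 1 : Fin (n + 1) → ℝ) = Pi.single a' 1 - Pi.single b' 1) :
    a = a' ∧ b = b' := by
  have h1 := (positive_root_le_iff (a' := a') (b' := b') hab).1 ⟨0, by simp [h]⟩
  have h2 := (positive_root_le_iff (a' := a) (b' := b) hab').1 ⟨0, by simp [h]⟩
  exact ⟨le_antisymm h2.1 h1.1, le_antisymm h1.2 h2.2⟩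

/-- A relation between the letters below `i` and the others which is closed under raising the
first and lowering the second argument is the inversion relation of a permutation
increasing on both blocks. -/
theorem exists_perm_inversion_iff {m i : ℕ} (R : Fin m → Fin m → Prop)
    (hR : ∀ a b a' b' : Fin m, (a' : ℕ) < i → i ≤ (b : ℕ) →
      a ≤ a' → b' ≤ b → i ≤ (b' : ℕ) → R a b → R a' b') :
    ∃ w : Equiv.Perm (Fin m),
      (∀ a b : Fin m, (a : ℕ) < i → (b : ℕ) < i → a < b → w a < w b) ∧
      (∀ a b : Fin m, i ≤ (a : ℕ) → i ≤ (b : ℕ) → a < b → w a < w b) ∧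
      ∀ a b : Fin m, (a : ℕ) < i → i ≤ (b : ℕ) → (w b < w a ↔ R a b) := by
  obtain ⟨w, hw⟩ := Fin.exists_perm_lt_iff
    (fun x y : Fin m =>
      ((x : ℕ) < i ∧ (y : ℕ) < i ∧ x < y) ∨ (i ≤ (x : ℕ) ∧ i ≤ (y : ℕ) ∧ x < y) ∨
        ((x : ℕ) < i ∧ i ≤ (y : ℕ) ∧ ¬ R x y) ∨ (i ≤ (x : ℕ) ∧ (y : ℕ) < i ∧ R y x))
    (by grind) (by grind) (by grind)
  refine ⟨w, ?_, ?_, ?_⟩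
  · intro a b ha hb hab
    exact (hw a b).2 (Or.inl ⟨ha, hb, hab⟩)
  · intro a b ha hb hab
    exact (hw a b).2 (Or.inr (Or.inl ⟨ha, hb, hab⟩))
  · intro a b ha hb
    rw [hw]
    grind

/-- Type A_n: for N ⊆ M_i, the set M_i \ N is a dual order ideal of Φ⁺ iff N is the
inversion set (restricted to M_i) of a permutation strictly increasing on the first i
letters and on the last n+1−i letters (a minimal coset representative in W^i). -/
theorem typeA_ideal_complements_are_inversion_sets (n i : ℕ)
    (hn : 1 ≤ n) (hi1 : 1 ≤ i) (hin : i ≤ n)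
    (e : Fin (n+1) → (Fin (n+1) → ℝ))
    (he : ∀ a, e a = fun k => if k = a then (1 : ℝ) else 0)
    (Φpos : Set (Fin (n+1) → ℝ))
    (hΦpos : Φpos = {v | ∃ a b : Fin (n+1), a < b ∧ v = e a - e b})
    (rle : (Fin (n+1) → ℝ) → (Fin (n+1) → ℝ) → Prop)
    (hrle : ∀ β γ, rle β γ ↔ ∃ c : Fin n → ℕ,
        γ - β = ∑ k : Fin n, (c k : ℝ) • (e k.castSucc - e k.succ))
    (Mi : Set (Fin (n+1) → ℝ))
    (hMi : Mi = {v | ∃ a b : Fin (n+1), (a : ℕ) < i ∧ i ≤ (b : ℕ) ∧ v = e a - e b})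
    (N : Set (Fin (n+1) → ℝ)) (hN : N ⊆ Mi) :
    (∀ β ∈ Mi \ N, ∀ γ ∈ Φpos, rle β γ → γ ∈ Mi \ N) ↔
      ∃ w : Equiv.Perm (Fin (n+1)),
        (∀ a b : Fin (n+1), (a : ℕ) < i → (b : ℕ) < i → a < b → w a < w b) ∧
        (∀ a b : Fin (n+1), i ≤ (a : ℕ) → i ≤ (b : ℕ) → a < b → w a < w b) ∧
        N = {v | ∃ a b : Fin (n+1), (a : ℕ) < i ∧ i ≤ (b : ℕ) ∧ w b < w a ∧ v = e a - e b} := by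
  obtain rfl : e = fun a => Pi.single a 1 := by
    funext a k
    rw [he, Pi.single_apply]
  subst hΦpos hMi
  constructor
  · intro hI
    obtain ⟨w, hw1, hw2, hw3⟩ := exists_perm_inversion_iff (i := i)
      (fun a b : Fin (n + 1) => (Pi.single a 1 - Pi.single b 1 : Fin (n + 1) → ℝ) ∈ N) (by
        intro a b a' b' ha' hb haa hbb hb' hab
        by_contra hnot
        have hlt : a' < b' := by omega
        exact (hI _ ⟨⟨a', b', ha', hb', rfl⟩, hnot⟩ _ ⟨a, b, by omega, rfl⟩
          ((hrle _ _).2 ((positive_root_le_iff hlt).2 ⟨haa, hbb⟩))).2 hab)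
    refine ⟨w, hw1, hw2, Set.ext fun v => ⟨fun hv => ?_, ?_⟩⟩
    · obtain ⟨a, b, ha, hb, rfl⟩ := hN hv
      exact ⟨a, b, ha, hb, (hw3 a b ha hb).2 hv, rfl⟩
    · rintro ⟨a, b, ha, hb, hlt, rfl⟩
      exact (hw3 a b ha hb).1 hlt
  · rintro ⟨w, hw1, hw2, rfl⟩ β ⟨⟨a, b, ha, hb, rfl⟩, hnot⟩ γ ⟨a', b', hab', rfl⟩ hle
    have hab : a < b := by omega
    obtain ⟨haa, hbb⟩ := (positive_root_le_iff hab).1 ((hrle _ _).1 hle)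
    have ha' : (a' : ℕ) < i := by omega
    have hb' : i ≤ (b' : ℕ) := by omega
    refine ⟨⟨a', b', ha', hb', rfl⟩, ?_⟩
    rintro ⟨x, y, hx, hy, hlt, heq⟩
    obtain ⟨rfl, rfl⟩ := positive_root_inj hab' (by omega) heq
    have hwab : w a ≤ w b := not_lt.1 fun h => hnot ⟨a, b, ha, hb, h, rfl⟩
    have hwa : w a' ≤ w a := by
      rcases haa.eq_or_lt with h | h
      · rw [h]
      · exact (hw1 _ _ ha' ha h).le
    have hwb : w b ≤ w b' := by
      rcases hbb.eq_or_lt with h | h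
      · rw [h]
      · exact (hw2 _ _ hb hb' h).le
    exact absurd hlt (not_lt.2 (hwa.trans (hwab.trans hwb)))
end

section
/- Let n ≥ 1, fix i ∈ [n], and consider the type A_n setting in ℝ^{n+1}. Set M_i = {e_a − e_b : 1 ≤ a ≤ i < b ≤ n+1}. Let w be a permutation of {1, …, n+1} that is strictly increasing on {1, …, i} and strictly increasing on {i+1, …, n+1}, acting linearly on ℝ^{n+1} by w·e_a = e_{w(a)}. If γ, γ′ ∈ M_i and γ − γ′ is a nonnegative integer combination of the simple roots, then w·γ − w·γ′ is also a nonnegative integer combination of the simple roots. (This is the type A_n instance of the order-preservation property of minimal coset representatives on M_i.) -/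
/-- The difference of two terms of a finite sequence, the earlier minus the later, is a nonnegative
integer combination of the consecutive differences. -/
theorem exists_nat_combination_sub_of_le {V : Type*} [AddCommGroup V] [Module ℝ V] {n : ℕ}
    (e : Fin (n + 1) → V) (p q : Fin (n + 1)) (hpq : p ≤ q) :
    ∃ d : Fin n → ℕ, e p - e q = ∑ k : Fin n, (d k : ℝ) • (e k.castSucc - e k.succ) := by
  induction q using Fin.induction with
  | zero =>
    obtain rfl : p = 0 := Fin.le_zero_iff.mp hpq
    exact ⟨0, by simp⟩
  | succ q ih =>
    rcases hpq.eq_or_lt with rfl | hlt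
    · exact ⟨0, by simp⟩
    · obtain ⟨d, hd⟩ := ih (Fin.le_castSucc_iff.mpr hlt)
      refine ⟨d + Pi.single q 1, ?_⟩
      simp only [Pi.add_apply, Nat.cast_add, add_smul, Finset.sum_add_distrib, ← hd]
      rw [Finset.sum_eq_single q (fun k _ hk => by simp [hk]) (by simp)]
      simp

/-- The partial sums of the coordinates of a nonnegative combination of the simple roots are
nonnegative. -/
theorem sum_Iic_nonneg_of_nat_combination {n : ℕ} (c : Fin n → ℕ) (t : Fin (n + 1)) :
    0 ≤ ∑ j ∈ Finset.Iic t, (∑ k : Fin n, (c k : ℝ) •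
      (Pi.single k.castSucc 1 - Pi.single k.succ 1) : Fin (n + 1) → ℝ) j := by
  simp only [Finset.sum_apply]
  rw [Finset.sum_comm]
  refine Finset.sum_nonneg fun k _ => ?_
  simp only [Pi.smul_apply, smul_eq_mul, ← Finset.mul_sum, Pi.sub_apply, Finset.sum_sub_distrib,
    Finset.sum_pi_single', Finset.mem_Iic]
  refine mul_nonneg (Nat.cast_nonneg _) (sub_nonneg.mpr ?_)
  have hk := k.castSucc_lt_succ.le
  split_ifs with h₁ h₂
  · rfl
  · exact absurd (hk.trans h₁) h₂
  · exact zero_le_one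
  · rfl


/-- Type A_n: a minimal coset representative w ∈ W^i preserves the root order on M_i:
if γ − γ′ is a nonnegative integer combination of simple roots for γ, γ′ ∈ M_i, then so
is w·γ − w·γ′. -/
theorem typeA_min_coset_rep_preserves_order_on_Mi (n i : ℕ)
    (hn : 1 ≤ n) (hi1 : 1 ≤ i) (hin : i ≤ n)
    (e : Fin (n+1) → (Fin (n+1) → ℝ))
    (he : ∀ a, e a = fun k => if k = a then (1 : ℝ) else 0)
    (Mi : Set (Fin (n+1) → ℝ))
    (hMi : Mi = {v | ∃ a b : Fin (n+1), (a : ℕ) < i ∧ i ≤ (b : ℕ) ∧ v = e a - e b})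
    (w : Equiv.Perm (Fin (n+1)))
    (hw1 : ∀ a b : Fin (n+1), (a : ℕ) < i → (b : ℕ) < i → a < b → w a < w b)
    (hw2 : ∀ a b : Fin (n+1), i ≤ (a : ℕ) → i ≤ (b : ℕ) → a < b → w a < w b)
    (act : (Fin (n+1) → ℝ) → (Fin (n+1) → ℝ))
    (hact : ∀ x, act x = x ∘ w.symm)
    (γ γ' : Fin (n+1) → ℝ) (hγ : γ ∈ Mi) (hγ' : γ' ∈ Mi)
    (c : Fin n → ℕ)
    (hc : γ - γ' = ∑ k : Fin n, (c k : ℝ) • (e k.castSucc - e k.succ)) :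
    ∃ d : Fin n → ℕ, act γ - act γ' = ∑ k : Fin n, (d k : ℝ) • (e k.castSucc - e k.succ) := by
  obtain rfl : e = fun a => Pi.single a 1 := by
    funext a k
    simp [he, Pi.single_apply]
  subst hMi
  obtain ⟨a, b, ha, hb, rfl⟩ := hγ
  obtain ⟨a', b', ha', hb', rfl⟩ := hγ'
  have key (t : Fin (n + 1)) : (0 : ℝ) ≤ ((if a ≤ t then 1 else 0) - (if b ≤ t then 1 else 0)) -
      ((if a' ≤ t then 1 else 0) - (if b' ≤ t then 1 else 0)) := by
    have h := sum_Iic_nonneg_of_nat_combination c t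
    rw [← hc] at h
    simpa only [Pi.sub_apply, Finset.sum_sub_distrib, Finset.sum_pi_single', Finset.mem_Iic] using h
  have haa : a ≤ a' := by
    by_contra hlt
    have h := key a'
    have h₁ : ¬ b ≤ a' := by rw [Fin.le_def]; lia
    have h₂ : ¬ b' ≤ a' := by rw [Fin.le_def]; lia
    norm_num [hlt, h₁, h₂] at h
  have hbb : b' ≤ b := by
    by_contra hlt
    have h := key b
    have h₁ : a ≤ b := by rw [Fin.le_def]; lia
    have h₂ : a' ≤ b := by rw [Fin.le_def]; lia
    norm_num [hlt, h₁, h₂] at h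
  have hwa : w a ≤ w a' := haa.eq_or_lt.elim (fun h => h ▸ le_rfl) fun h => (hw1 _ _ ha ha' h).le
  have hwb : w b' ≤ w b := hbb.eq_or_lt.elim (fun h => h ▸ le_rfl) fun h => (hw2 _ _ hb' hb h).le
  obtain ⟨d₁, h₁⟩ := exists_nat_combination_sub_of_le
    (fun x => (Pi.single x 1 : Fin (n + 1) → ℝ)) _ _ hwa
  obtain ⟨d₂, h₂⟩ := exists_nat_combination_sub_of_le
    (fun x => (Pi.single x 1 : Fin (n + 1) → ℝ)) _ _ hwb
  refine ⟨d₁ + d₂, ?_⟩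
  simp only [Pi.add_apply, Nat.cast_add, add_smul, Finset.sum_add_distrib, ← h₁, ← h₂, hact]
  funext k
  simp only [Pi.sub_apply, Pi.add_apply, Function.comp_apply, Pi.single_apply,
    Equiv.symm_apply_eq]
  ring
end

section
/- Let n ≥ 1, fix i ∈ [n], and consider the type A_n setting in ℝ^{n+1} with M_i = {e_a − e_b : 1 ≤ a ≤ i < b ≤ n+1}. Then: (1) conv(M_i) is the union, over all staircase paths p for i, of the convex hulls conv(R(p)) of their root sets; (2) for any two staircase paths p, q for i, conv(R(p)) ∩ conv(R(q)) = conv(R(p) ∩ R(q)). (Hence the convex hulls of the root sets of staircase paths form a triangulation of the standard parabolic facet conv(M_i) of the type A_n root polytope.) -/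
/-- The `a`-th standard basis vector of `ℝ^{n+1}`, with 1-based index `a`. -/
noncomputable def stdA (n : ℕ) (a : ℕ) : Fin (n+1) → ℝ := fun j => if (j : ℕ) + 1 = a then 1 else 0

/-- A staircase path for `i` in the rectangle `M_i` of type `A_n`: a sequence of pairs
`(a_1,b_1), …, (a_n,b_n)` with `(a_1,b_1) = (1, i+1)`, `(a_n,b_n) = (i, n+1)`, where each
step increases either the first or the second coordinate by one. -/
def IsStairA (n i : ℕ) (a b : ℕ → ℕ) : Prop :=
  a 1 = 1 ∧ b 1 = i + 1 ∧ a n = i ∧ b n = n + 1 ∧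
  ∀ k, 1 ≤ k → k + 1 ≤ n →
    (a (k+1) = a k + 1 ∧ b (k+1) = b k) ∨ (a (k+1) = a k ∧ b (k+1) = b k + 1)

/-- The root set of a staircase path in type `A_n`. -/
noncomputable def RsetA (n : ℕ) (a b : ℕ → ℕ) : Set (Fin (n+1) → ℝ) :=
  {v | ∃ k, 1 ≤ k ∧ k ≤ n ∧ v = stdA n (a k) - stdA n (b k)}

theorem sum_Icc_eq_add_sum_Icc_succ {M : Type*} [AddCommMonoid M] {p q : ℕ} (h : p ≤ q)
    (F : ℕ → M) : ∑ k ∈ Finset.Icc p q, F k = F p + ∑ k ∈ Finset.Icc (p + 1) q, F k := by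
  rw [← Finset.insert_Icc_add_one_left_eq_Icc h, Finset.sum_insert (by simp)]

theorem sum_Icc_succ_update {M R : Type*} [AddCommMonoid M] {p q : ℕ} (γ : ℕ → R) (c : R)
    (F : ℕ → R → M) : ∑ k ∈ Finset.Icc (p + 1) q, F k (Function.update γ p c k) =
      ∑ k ∈ Finset.Icc (p + 1) q, F k (γ k) := by
  refine Finset.sum_congr rfl fun k hk => ?_
  rw [Function.update_of_ne (by have := Finset.mem_Icc.1 hk; omega)]

section ConvexCombinations

variable {ι E : Type*} [AddCommGroup E] [Module ℝ E]

theorem exists_weights_of_mem_convexHull_image {s : Finset ι} {f : ι → E} {x : E}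
    (hx : x ∈ convexHull ℝ (f '' (s : Set ι))) :
    ∃ w : ι → ℝ, (∀ k, 0 ≤ w k) ∧ ∑ k ∈ s, w k = 1 ∧ ∑ k ∈ s, w k • f k = x := by
  classical
  have hsub : convexHull ℝ (f '' (s : Set ι)) ⊆
      {x | ∃ w : ι → ℝ, (∀ k, 0 ≤ w k) ∧ ∑ k ∈ s, w k = 1 ∧ ∑ k ∈ s, w k • f k = x} := by
    apply convexHull_min
    · rintro _ ⟨k, hk, rfl⟩
      have hk' : k ∈ s := hk
      refine ⟨fun j => if j = k then 1 else 0, fun j => ?_, ?_, ?_⟩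
      · dsimp only
        split_ifs <;> norm_num
      · simp [hk']
      · simp [ite_smul, hk']
    · rintro _ ⟨w, hw, hw1, rfl⟩ _ ⟨u, hu, hu1, rfl⟩ c d hc hd hcd
      refine ⟨fun k => c * w k + d * u k, fun k => ?_, ?_, ?_⟩
      · have := hw k
        have := hu k
        positivity
      · rw [Finset.sum_add_distrib, ← Finset.mul_sum, ← Finset.mul_sum, hw1, hu1]
        linarith
      · simp only [add_smul, mul_smul, Finset.sum_add_distrib, Finset.smul_sum]
  exact hsub hx

theorem sum_smul_mem_convexHull_of_ne_zero {s : Finset ι} {f : ι → E} {w : ι → ℝ} {T : Set E}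
    (hw : ∀ k ∈ s, 0 ≤ w k) (hw1 : ∑ k ∈ s, w k = 1) (hT : ∀ k ∈ s, w k ≠ 0 → f k ∈ T) :
    ∑ k ∈ s, w k • f k ∈ convexHull ℝ T := by
  classical
  have hfil : ∑ k ∈ s with w k ≠ 0, w k • f k = ∑ k ∈ s, w k • f k :=
    Finset.sum_filter_of_ne fun k _ h h0 => h (by rw [h0, zero_smul])
  rw [← hfil]
  refine (convex_convexHull ℝ T).sum_mem (fun k hk => hw k (Finset.mem_filter.1 hk).1) ?_ ?_
  · rw [Finset.sum_filter_ne_zero, hw1]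
  · intro k hk
    exact subset_convexHull ℝ T (hT k (Finset.mem_filter.1 hk).1 (Finset.mem_filter.1 hk).2)

/-- The north-west corner rule: two nonnegative sequences of the same total mass are the marginals
of a nonnegative weight supported on a staircase. -/
theorem exists_staircase_of_marginals (f g : ℕ → E) (d s t i m : ℕ) (hs : s ≤ i) (ht : t ≤ m)
    (hd : d = (i - s) + (m - t)) (α β : ℕ → ℝ) (hα : ∀ a, 0 ≤ α a) (hβ : ∀ b, 0 ≤ β b)
    (hαβ : ∑ a ∈ Finset.Icc s i, α a = ∑ b ∈ Finset.Icc t m, β b) :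
    ∃ (a b : ℕ → ℕ) (w : ℕ → ℝ), a 0 = s ∧ b 0 = t ∧ a d = i ∧ b d = m ∧
      (∀ k < d, (a (k + 1) = a k + 1 ∧ b (k + 1) = b k) ∨
        (a (k + 1) = a k ∧ b (k + 1) = b k + 1)) ∧
      (∀ k, 0 ≤ w k) ∧ ∑ k ∈ Finset.range (d + 1), w k = ∑ a ∈ Finset.Icc s i, α a ∧
      ∑ k ∈ Finset.range (d + 1), w k • (f (a k) - g (b k)) =
        ∑ a ∈ Finset.Icc s i, α a • f a - ∑ b ∈ Finset.Icc t m, β b • g b := by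
  induction d generalizing s t α β with
  | zero =>
    obtain rfl : s = i := by omega
    obtain rfl : t = m := by omega
    simp only [Finset.Icc_self, Finset.sum_singleton] at hαβ ⊢
    refine ⟨fun _ => s, fun _ => t, fun _ => α s, rfl, rfl, rfl, rfl, by simp,
      fun _ => hα s, by simp, ?_⟩
    simp [smul_sub, hαβ]
  | succ d ih =>
    have update_nonneg (γ : ℕ → ℝ) (hγ : ∀ k, 0 ≤ γ k) (p : ℕ) (c : ℝ) (hc : 0 ≤ c) (k : ℕ) :
        0 ≤ Function.update γ p c k := by
      rw [Function.update_apply]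
      split_ifs
      · exact hc
      · exact hγ k
    have step : (s < i ∧ α s ≤ β t) ∨ (t < m ∧ β t ≤ α s) := by
      rcases hs.lt_or_eq with hs' | rfl
      · rcases ht.lt_or_eq with ht' | rfl
        · rcases le_total (α s) (β t) with h | h
          · exact Or.inl ⟨hs', h⟩
          · exact Or.inr ⟨ht', h⟩
        · refine Or.inl ⟨hs', ?_⟩
          rw [Finset.Icc_self, Finset.sum_singleton] at hαβ
          rw [← hαβ]
          exact Finset.single_le_sum (fun k _ => hα k) (Finset.mem_Icc.2 ⟨le_rfl, hs⟩)
      · refine Or.inr ⟨by omega, ?_⟩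
        rw [Finset.Icc_self, Finset.sum_singleton] at hαβ
        rw [hαβ]
        exact Finset.single_le_sum (fun k _ => hβ k) (Finset.mem_Icc.2 ⟨le_rfl, ht⟩)
    rcases step with ⟨hs', h⟩ | ⟨ht', h⟩
    · obtain ⟨a, b, w, ha0, hb0, had, hbd, hst, hw, hw1, hwx⟩ :=
        ih (s + 1) t hs' ht (by omega) α (Function.update β t (β t - α s)) hα
          (update_nonneg β hβ t _ (by linarith)) (by
            rw [sum_Icc_eq_add_sum_Icc_succ ht,
              sum_Icc_succ_update β _ (fun _ c => c), Function.update_self]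
            rw [sum_Icc_eq_add_sum_Icc_succ hs, sum_Icc_eq_add_sum_Icc_succ ht] at hαβ
            linarith)
      refine ⟨fun k => k.casesOn s a, fun k => k.casesOn t b,
        fun k => k.casesOn (α s) w, rfl, rfl, had, hbd,
        ?_, ?_, ?_, ?_⟩
      · rintro (_ | k) hk
        · exact Or.inl ⟨ha0, hb0⟩
        · exact hst k (by omega)
      · rintro (_ | k)
        · exact hα s
        · exact hw k
      · rw [Finset.sum_range_succ', sum_Icc_eq_add_sum_Icc_succ hs, ← hw1]
        exact add_comm _ _
      · rw [Finset.sum_range_succ', sum_Icc_eq_add_sum_Icc_succ hs]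
        refine (congrArg (· + α s • (f s - g t)) hwx).trans ?_
        rw [sum_Icc_eq_add_sum_Icc_succ ht, sum_Icc_eq_add_sum_Icc_succ ht,
          sum_Icc_succ_update β _ (fun k c => c • g k), Function.update_self]
        module
    · obtain ⟨a, b, w, ha0, hb0, had, hbd, hst, hw, hw1, hwx⟩ :=
        ih s (t + 1) hs ht' (by omega) (Function.update α s (α s - β t)) β
          (update_nonneg α hα s _ (by linarith)) hβ (by
            rw [sum_Icc_eq_add_sum_Icc_succ hs,
              sum_Icc_succ_update α _ (fun _ c => c), Function.update_self]
            rw [sum_Icc_eq_add_sum_Icc_succ hs, sum_Icc_eq_add_sum_Icc_succ ht] at hαβ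
            linarith)
      refine ⟨fun k => k.casesOn s a, fun k => k.casesOn t b,
        fun k => k.casesOn (β t) w, rfl, rfl, had, hbd,
        ?_, ?_, ?_, ?_⟩
      · rintro (_ | k) hk
        · exact Or.inr ⟨ha0, hb0⟩
        · exact hst k (by omega)
      · rintro (_ | k)
        · exact hβ t
        · exact hw k
      · rw [Finset.sum_range_succ', sum_Icc_eq_add_sum_Icc_succ hs]
        refine (congrArg (· + β t) hw1).trans ?_
        rw [sum_Icc_eq_add_sum_Icc_succ hs,
          sum_Icc_succ_update α _ (fun _ c => c), Function.update_self]
        ring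
      · rw [Finset.sum_range_succ', sum_Icc_eq_add_sum_Icc_succ ht]
        refine (congrArg (· + β t • (f s - g t)) hwx).trans ?_
        rw [sum_Icc_eq_add_sum_Icc_succ hs, sum_Icc_eq_add_sum_Icc_succ hs,
          sum_Icc_succ_update α _ (fun k c => c • f k), Function.update_self]
        module

end ConvexCombinations

section MonotoneCoupling

/-- The joint distribution function of a weight on a chain is the minimum of its marginal
distribution functions. -/
theorem sum_ite_and_eq_min {S : Finset ℕ} {a b : ℕ → ℕ} {w : ℕ → ℝ} (hw : ∀ k, 0 ≤ w k)
    (ha : MonotoneOn a S) (hb : MonotoneOn b S) (s t : ℕ) :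
    ∑ k ∈ S, (if a k ≤ s ∧ b k ≤ t then w k else 0) =
      min (∑ k ∈ S, if a k ≤ s then w k else 0) (∑ k ∈ S, if b k ≤ t then w k else 0) := by
  have hA : ∑ k ∈ S, (if a k ≤ s ∧ b k ≤ t then w k else 0) ≤
      ∑ k ∈ S, if a k ≤ s then w k else 0 :=
    Finset.sum_le_sum fun k _ => by have := hw k; split_ifs <;> first | rfl | assumption | tauto
  have hB : ∑ k ∈ S, (if a k ≤ s ∧ b k ≤ t then w k else 0) ≤
      ∑ k ∈ S, if b k ≤ t then w k else 0 :=
    Finset.sum_le_sum fun k _ => by have := hw k; split_ifs <;> first | rfl | assumption | tauto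
  by_cases h : ∀ k ∈ S, a k ≤ s → b k ≤ t
  · have hEq : ∑ k ∈ S, (if a k ≤ s ∧ b k ≤ t then w k else 0) =
        ∑ k ∈ S, if a k ≤ s then w k else 0 :=
      Finset.sum_congr rfl fun k hk => by simp only [and_iff_left_of_imp (h k hk)]
    rw [← hEq, min_eq_left hB]
  · push Not at h
    obtain ⟨k, hk, hak, hbk⟩ := h
    have h' : ∀ l ∈ S, b l ≤ t → a l ≤ s := by
      intro l hl hbl
      rcases le_total k l with hkl | hlk
      · have := hb hk hl hkl
        omega
      · exact (ha hl hk hlk).trans hak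
    have hEq : ∑ k ∈ S, (if a k ≤ s ∧ b k ≤ t then w k else 0) =
        ∑ k ∈ S, if b k ≤ t then w k else 0 :=
      Finset.sum_congr rfl fun l hl => by simp only [and_iff_right_of_imp (h' l hl)]
    rw [← hEq, min_eq_right hA]

theorem sum_ite_eq_and_eq (S : Finset ℕ) (a b : ℕ → ℕ) (w : ℕ → ℝ) (s t : ℕ) :
    ∑ k ∈ S, (if a k = s + 1 ∧ b k = t + 1 then w k else 0) =
      ∑ k ∈ S, (if a k ≤ s + 1 ∧ b k ≤ t + 1 then w k else 0)
        - ∑ k ∈ S, (if a k ≤ s ∧ b k ≤ t + 1 then w k else 0)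
        - ∑ k ∈ S, (if a k ≤ s + 1 ∧ b k ≤ t then w k else 0)
        + ∑ k ∈ S, (if a k ≤ s ∧ b k ≤ t then w k else 0) := by
  rw [← Finset.sum_sub_distrib, ← Finset.sum_sub_distrib, ← Finset.sum_add_distrib]
  refine Finset.sum_congr rfl fun k _ => ?_
  split_ifs <;> first | omega | ring

/-- Two weights on chains with the same marginals have the same support. -/
theorem exists_eq_of_marginals_eq {S : Finset ℕ} {a b a' b' : ℕ → ℕ} {w u : ℕ → ℝ}
    (hw : ∀ k, 0 ≤ w k) (hu : ∀ k, 0 ≤ u k) (ha : MonotoneOn a S) (hb : MonotoneOn b S)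
    (ha' : MonotoneOn a' S) (hb' : MonotoneOn b' S)
    (hA : ∀ s, ∑ k ∈ S, (if a k ≤ s then w k else 0) = ∑ k ∈ S, if a' k ≤ s then u k else 0)
    (hB : ∀ t, ∑ k ∈ S, (if b k ≤ t then w k else 0) = ∑ k ∈ S, if b' k ≤ t then u k else 0)
    {k : ℕ} (hk : k ∈ S) (hak : 1 ≤ a k) (hbk : 1 ≤ b k) (hwk : w k ≠ 0) :
    ∃ l ∈ S, a' l = a k ∧ b' l = b k := by
  have hF (s t : ℕ) : ∑ k ∈ S, (if a k ≤ s ∧ b k ≤ t then w k else 0) =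
      ∑ k ∈ S, (if a' k ≤ s ∧ b' k ≤ t then u k else 0) := by
    rw [sum_ite_and_eq_min hw ha hb, sum_ite_and_eq_min hu ha' hb', hA, hB]
  have hG (s t : ℕ) : ∑ k ∈ S, (if a k = s + 1 ∧ b k = t + 1 then w k else 0) =
      ∑ k ∈ S, (if a' k = s + 1 ∧ b' k = t + 1 then u k else 0) := by
    simp only [sum_ite_eq_and_eq, hF]
  by_contra! hno
  have h0 := hG (a k - 1) (b k - 1)
  rw [Nat.sub_add_cancel hak, Nat.sub_add_cancel hbk] at h0
  rw [Finset.sum_eq_zero (s := S) (f := fun l => if a' l = a k ∧ b' l = b k then u l else 0)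
    fun l hl => if_neg fun h => hno l hl h.1 h.2] at h0
  have := (Finset.sum_eq_zero_iff_of_nonneg fun l _ => by
    have := hw l
    split_ifs <;> first | rfl | assumption).1 h0 k hk
  simp only [and_self, if_true] at this
  exact hwk this

end MonotoneCoupling

namespace IsStairA

variable {n i : ℕ} {a b : ℕ → ℕ}

theorem le_of_le (h : IsStairA n i a b) {k l : ℕ} (hk : 1 ≤ k) (hkl : k ≤ l) (hl : l ≤ n) :
    a k ≤ a l ∧ b k ≤ b l := by
  induction l, hkl using Nat.le_induction with
  | base => exact ⟨le_rfl, le_rfl⟩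
  | succ l hkl ih =>
    have := ih (by omega)
    have := h.2.2.2.2 l (by omega) hl
    omega

theorem monotoneOn_left (h : IsStairA n i a b) : MonotoneOn a (Finset.Icc 1 n) := by
  intro k hk l hl hkl
  rw [Finset.coe_Icc, Set.mem_Icc] at hk hl
  exact (h.le_of_le hk.1 hkl hl.2).1

theorem monotoneOn_right (h : IsStairA n i a b) : MonotoneOn b (Finset.Icc 1 n) := by
  intro k hk l hl hkl
  rw [Finset.coe_Icc, Set.mem_Icc] at hk hl
  exact (h.le_of_le hk.1 hkl hl.2).2

theorem bounds (h : IsStairA n i a b) {k : ℕ} (hk : 1 ≤ k) (hkn : k ≤ n) :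
    1 ≤ a k ∧ a k ≤ i ∧ i < b k ∧ b k ≤ n + 1 := by
  have h1 := h.le_of_le le_rfl hk hkn
  have h2 := h.le_of_le hk hkn le_rfl
  obtain ⟨e1, e2, e3, e4, -⟩ := h
  omega

end IsStairA

theorem RsetA_eq_image (n : ℕ) (a b : ℕ → ℕ) :
    RsetA n a b = (fun k => stdA n (a k) - stdA n (b k)) '' (Finset.Icc 1 n : Finset ℕ) := by
  ext v
  simp only [RsetA, Set.mem_ofPred_eq, Set.mem_image, Finset.coe_Icc, Set.mem_Icc, and_assoc,
    eq_comm]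

/-- The sum of the first `s` coordinates. -/
noncomputable def initialSum (n s : ℕ) : (Fin (n + 1) → ℝ) →ₗ[ℝ] ℝ :=
  ∑ j ∈ (Finset.univ.filter fun j : Fin (n + 1) => (j : ℕ) + 1 ≤ s), LinearMap.proj j

theorem initialSum_stdA {n s c : ℕ} (hc : 1 ≤ c) (hcn : c ≤ n + 1) :
    initialSum n s (stdA n c) = if c ≤ s then 1 else 0 := by
  have hc' : c - 1 < n + 1 := by omega
  have hj (j : Fin (n + 1)) : (j : ℕ) + 1 = c ↔ j = ⟨c - 1, hc'⟩ := by
    have h : (j : ℕ) + 1 = c ↔ (j : ℕ) = c - 1 := by omega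
    exact h.trans (Fin.ext_iff (b := ⟨c - 1, hc'⟩)).symm
  simp only [initialSum, LinearMap.sum_apply, LinearMap.proj_apply, stdA, hj,
    Finset.sum_ite_eq', Finset.mem_filter, Finset.mem_univ, true_and, Nat.sub_add_cancel hc]

namespace IsStairA

variable {n i : ℕ} {a b : ℕ → ℕ}

theorem sum_left_le_eq (h : IsStairA n i a b) {w : ℕ → ℝ} (hw1 : ∑ k ∈ Finset.Icc 1 n, w k = 1)
    (s : ℕ) : ∑ k ∈ Finset.Icc 1 n, (if a k ≤ s then w k else 0) =
      if s ≤ i then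
        initialSum n s (∑ k ∈ Finset.Icc 1 n, w k • (stdA n (a k) - stdA n (b k))) else 1 := by
  split_ifs with hs
  · rw [map_sum]
    refine Finset.sum_congr rfl fun k hk => ?_
    rw [Finset.mem_Icc] at hk
    have := h.bounds hk.1 hk.2
    rw [map_smul, map_sub, initialSum_stdA (by omega) (by omega),
      initialSum_stdA (by omega) (by omega), if_neg (show ¬ b k ≤ s by omega)]
    simp
  · rw [← hw1]
    refine Finset.sum_congr rfl fun k hk => if_pos ?_
    rw [Finset.mem_Icc] at hk
    have := h.bounds hk.1 hk.2
    omega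

theorem sum_right_le_eq (h : IsStairA n i a b) {w : ℕ → ℝ}
    (hw1 : ∑ k ∈ Finset.Icc 1 n, w k = 1) (t : ℕ) :
    ∑ k ∈ Finset.Icc 1 n, (if b k ≤ t then w k else 0) =
      if t ≤ i then 0 else
        1 - initialSum n t (∑ k ∈ Finset.Icc 1 n, w k • (stdA n (a k) - stdA n (b k))) := by
  split_ifs with ht
  · refine Finset.sum_eq_zero fun k hk => if_neg ?_
    rw [Finset.mem_Icc] at hk
    have := h.bounds hk.1 hk.2
    omega
  · rw [map_sum, ← hw1, ← Finset.sum_sub_distrib]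
    refine Finset.sum_congr rfl fun k hk => ?_
    rw [Finset.mem_Icc] at hk
    have := h.bounds hk.1 hk.2
    rw [map_smul, map_sub, initialSum_stdA (by omega) (by omega),
      initialSum_stdA (by omega) (by omega), if_pos (show a k ≤ t by omega)]
    split_ifs <;> simp

theorem convexHull_inter_subset {a' b' : ℕ → ℕ} (hp : IsStairA n i a b)
    (hq : IsStairA n i a' b') :
    convexHull ℝ (RsetA n a b) ∩ convexHull ℝ (RsetA n a' b') ⊆
      convexHull ℝ (RsetA n a b ∩ RsetA n a' b') := by
  rintro x ⟨hxp, hxq⟩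
  rw [RsetA_eq_image] at hxp hxq
  obtain ⟨w, hw, hw1, hwx⟩ := exists_weights_of_mem_convexHull_image hxp
  obtain ⟨u, hu, hu1, hux⟩ := exists_weights_of_mem_convexHull_image hxq
  rw [← hwx]
  refine sum_smul_mem_convexHull_of_ne_zero (fun k _ => hw k) hw1 fun k hk hwk => ?_
  have hk' := Finset.mem_Icc.1 hk
  have hbd := hp.bounds hk'.1 hk'.2
  obtain ⟨l, hl, hal, hbl⟩ := exists_eq_of_marginals_eq hw hu hp.monotoneOn_left
    hp.monotoneOn_right hq.monotoneOn_left hq.monotoneOn_right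
    (fun s => by rw [hp.sum_left_le_eq hw1, hq.sum_left_le_eq hu1, hwx, hux])
    (fun t => by rw [hp.sum_right_le_eq hw1, hq.sum_right_le_eq hu1, hwx, hux])
    hk (by omega) (by omega) hwk
  have hl' := Finset.mem_Icc.1 hl
  exact ⟨⟨k, hk'.1, hk'.2, rfl⟩, ⟨l, hl'.1, hl'.2, by rw [hal, hbl]⟩⟩

end IsStairA

theorem exists_isStairA_mem_convexHull {n i : ℕ} (hi1 : 1 ≤ i) (hin : i ≤ n)
    {x : Fin (n + 1) → ℝ}
    (hx : x ∈ convexHull ℝ ((fun p : ℕ × ℕ => stdA n p.1 - stdA n p.2) ''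
      (Finset.Icc 1 i ×ˢ Finset.Icc (i + 1) (n + 1) : Finset (ℕ × ℕ)))) :
    ∃ a b : ℕ → ℕ, IsStairA n i a b ∧ x ∈ convexHull ℝ (RsetA n a b) := by
  obtain ⟨w, hw, hw1, hwx⟩ := exists_weights_of_mem_convexHull_image hx
  rw [Finset.sum_product] at hw1
  obtain ⟨a, b, u, ha0, hb0, had, hbd, hst, hu, hu1, hux⟩ :=
    exists_staircase_of_marginals (stdA n) (stdA n) (n - 1) 1 (i + 1) i (n + 1) hi1 (by omega)
      (by omega) (fun s => ∑ t ∈ Finset.Icc (i + 1) (n + 1), w (s, t))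
      (fun t => ∑ s ∈ Finset.Icc 1 i, w (s, t)) (fun s => Finset.sum_nonneg fun _ _ => hw _)
      (fun t => Finset.sum_nonneg fun _ _ => hw _) Finset.sum_comm
  refine ⟨fun k => a (k - 1), fun k => b (k - 1), ⟨ha0, hb0, had, hbd, ?_⟩, ?_⟩
  · intro k hk hkn
    obtain ⟨k, rfl⟩ := Nat.exists_eq_add_of_le' hk
    exact hst k (by omega)
  · have hxu : x = ∑ k ∈ Finset.range (n - 1 + 1), u k • (stdA n (a k) - stdA n (b k)) := by
      rw [hux, ← hwx, Finset.sum_product]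
      simp only [smul_sub, Finset.sum_sub_distrib, Finset.sum_smul]
      congr 1
      exact Finset.sum_comm
    rw [hxu]
    refine sum_smul_mem_convexHull_of_ne_zero (fun k _ => hu k) (hu1.trans hw1) fun k hk _ => ?_
    have := Finset.mem_range.1 hk
    exact ⟨k + 1, by omega, by omega, rfl⟩

/-- Type A_n: the convex hulls of the root sets of staircase paths for i form a
triangulation of the standard parabolic facet conv(M_i). -/
theorem typeA_staircase_triangulation_of_facet (n i : ℕ)
    (hn : 1 ≤ n) (hi1 : 1 ≤ i) (hin : i ≤ n)
    (Mi : Set (Fin (n+1) → ℝ))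
    (hMi : Mi = {v | ∃ a b : ℕ, 1 ≤ a ∧ a ≤ i ∧ i < b ∧ b ≤ n + 1 ∧
        v = stdA n a - stdA n b}) :
    (convexHull ℝ Mi
        = {x | ∃ a b : ℕ → ℕ, IsStairA n i a b ∧ x ∈ convexHull ℝ (RsetA n a b)}) ∧
    (∀ pa pb qa qb : ℕ → ℕ, IsStairA n i pa pb → IsStairA n i qa qb →
      convexHull ℝ (RsetA n pa pb) ∩ convexHull ℝ (RsetA n qa qb)
        = convexHull ℝ (RsetA n pa pb ∩ RsetA n qa qb)) := by
  have hMi' : Mi = (fun p : ℕ × ℕ => stdA n p.1 - stdA n p.2) ''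
      (Finset.Icc 1 i ×ˢ Finset.Icc (i + 1) (n + 1) : Finset (ℕ × ℕ)) := by
    rw [hMi]
    ext v
    constructor
    · rintro ⟨a, b, h1, h2, h3, h4, rfl⟩
      exact ⟨(a, b), by simp; omega, rfl⟩
    · rintro ⟨⟨a, b⟩, hab, rfl⟩
      simp only [Finset.coe_product, Finset.coe_Icc, Set.mem_prod, Set.mem_Icc] at hab
      exact ⟨a, b, by omega, by omega, by omega, by omega, rfl⟩
  refine ⟨Set.Subset.antisymm ?_ ?_, fun pa pb qa qb hp hq =>
    Set.Subset.antisymm (hp.convexHull_inter_subset hq) (Set.subset_inter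
      (convexHull_mono Set.inter_subset_left) (convexHull_mono Set.inter_subset_right))⟩
  · intro x hx
    rw [hMi'] at hx
    exact exists_isStairA_mem_convexHull hi1 hin hx
  · rintro x ⟨a, b, h, hx⟩
    refine convexHull_mono ?_ hx
    rintro v ⟨k, hk, hkn, rfl⟩
    obtain ⟨h1, h2, h3, h4⟩ := h.bounds hk hkn
    rw [hMi]
    exact ⟨a k, b k, h1, h2, h3, h4, rfl⟩
end

section
/- Let n ≥ 1 and consider the type C_n setting in ℝ^n with M = {e_a + e_b : 1 ≤ a ≤ b ≤ n}. Then: (1) conv(M) = conv({2e_j : j ∈ [n]}); (2) conv(M) is the union, over all staircase paths p, of the convex hulls conv(R(p)) of their root sets; (3) for any two staircase paths p, q, conv(R(p)) ∩ conv(R(q)) = conv(R(p) ∩ R(q)). (Hence the convex hulls of the root sets of the 2^{n−1} staircase paths form a triangulation of the unique standard parabolic facet conv(M) of the type C_n root polytope.) -/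
/-- A staircase path in type `C_n`: a sequence of pairs `(a_1,b_1), …, (a_n,b_n)` with
`(a_1,b_1) = (1,n)`, where each step either increases the first coordinate by one or
decreases the second coordinate by one. -/
def IsStairC (n : ℕ) (a b : ℕ → ℕ) : Prop :=
  a 1 = 1 ∧ b 1 = n ∧
  ∀ k, 1 ≤ k → k + 1 ≤ n →
    (a (k+1) = a k + 1 ∧ b (k+1) = b k) ∨ (a (k+1) = a k ∧ b k = b (k+1) + 1)

/-- The root set of a staircase path in type `C_n`. -/
noncomputable def RsetC (n : ℕ) (a b : ℕ → ℕ) : Set (Fin n → ℝ) :=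
  {v | ∃ k, 1 ≤ k ∧ k ≤ n ∧ v = stdC n (a k) + stdC n (b k)}

namespace IsStairC

variable {n : ℕ} {a b : ℕ → ℕ}

lemma mono (h : IsStairC n a b) {k l : ℕ} (hk : 1 ≤ k) (hkl : k ≤ l) (hl : l ≤ n) :
    a k ≤ a l ∧ b l ≤ b k := by
  induction l, hkl using Nat.le_induction with
  | base => simp
  | succ l hkl ih =>
    have := ih (by omega)
    rcases h.2.2 l (by omega) hl with h' | h' <;> omega

lemma add_eq (h : IsStairC n a b) {k : ℕ} (hk : 1 ≤ k) (hkn : k ≤ n) :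
    a k + n = b k + k := by
  induction k, hk using Nat.le_induction with
  | base => rw [h.1, h.2.1]; omega
  | succ l hl ih =>
    have := ih (by omega)
    rcases h.2.2 l (by omega) hkn with h' | h' <;> omega

lemma left_le_right (h : IsStairC n a b) {k l : ℕ} (hk : 1 ≤ k) (hkn : k ≤ n)
    (hl : 1 ≤ l) (hln : l ≤ n) : a k ≤ b l := by
  have h₁ := (h.mono hk hkn le_rfl).1
  have h₂ := (h.mono hl hln le_rfl).2
  have h₃ := h.add_eq (hk.trans hkn) le_rfl
  omega

lemma bounds (h : IsStairC n a b) {k : ℕ} (hk : 1 ≤ k) (hkn : k ≤ n) :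
    1 ≤ a k ∧ a k ≤ b k ∧ b k ≤ n := by
  have h₁ := h.mono le_rfl hk hkn
  rw [h.1, h.2.1] at h₁
  exact ⟨h₁.1, h.left_le_right hk hkn hk hkn, h₁.2⟩

end IsStairC

/-- `w` is a system of convex weights expressing `x` through the roots of the path `(a, b)`. -/
structure IsPathWeight (n : ℕ) (a b : ℕ → ℕ) (x : Fin n → ℝ) (w : ℕ → ℝ) : Prop where
  nonneg : ∀ k, 0 ≤ w k
  sum_eq_one : ∑ k ∈ Finset.Icc 1 n, w k = 1
  eq_sum : x = ∑ k ∈ Finset.Icc 1 n, w k • (stdC n (a k) + stdC n (b k))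

lemma exists_isPathWeight {n : ℕ} {a b : ℕ → ℕ} {x : Fin n → ℝ}
    (hx : x ∈ convexHull ℝ (RsetC n a b)) : ∃ w, IsPathWeight n a b x w := by
  refine convexHull_min (t := {x | ∃ w, IsPathWeight n a b x w}) ?_ ?_ hx
  · rintro v ⟨k, hk, hkn, rfl⟩
    refine ⟨fun l => if l = k then 1 else 0, fun l => ?_, ?_, ?_⟩
    · positivity
    · simp [hk, hkn]
    · simp [Finset.sum_add_distrib, hk, hkn]
  · rintro x ⟨w, hw⟩ y ⟨v, hv⟩ s t hs ht hst
    refine ⟨fun k => s * w k + t * v k, fun k => ?_, ?_, ?_⟩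
    · have := hw.nonneg k
      have := hv.nonneg k
      positivity
    · rw [Finset.sum_add_distrib, ← Finset.mul_sum, ← Finset.mul_sum, hw.sum_eq_one,
        hv.sum_eq_one, mul_one, mul_one, hst]
    · simp only [add_smul, mul_smul, Finset.sum_add_distrib, ← Finset.smul_sum]
      rw [← hw.eq_sum, ← hv.eq_sum]

lemma IsPathWeight.mem_convexHull {n : ℕ} {a b : ℕ → ℕ} {x : Fin n → ℝ} {w : ℕ → ℝ}
    (hw : IsPathWeight n a b x w) {S : Set (Fin n → ℝ)}
    (hS : ∀ k, 1 ≤ k → k ≤ n → w k ≠ 0 → stdC n (a k) + stdC n (b k) ∈ S) :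
    x ∈ convexHull ℝ S := by
  classical
  have hfilter : ∀ k ∈ Finset.Icc 1 n, k ∉ (Finset.Icc 1 n).filter (w · ≠ 0) → w k = 0 := by
    intro k hk hk'
    by_contra hne
    exact hk' (Finset.mem_filter.2 ⟨hk, hne⟩)
  rw [hw.eq_sum, ← Finset.sum_subset (Finset.filter_subset (w · ≠ 0) _)
    fun k hk hk' => by rw [hfilter k hk hk', zero_smul]]
  refine (convex_convexHull ℝ S).sum_mem (fun k _ => hw.nonneg k) ?_ fun k hk => ?_
  · rw [Finset.sum_subset (Finset.filter_subset (w · ≠ 0) _) hfilter, hw.sum_eq_one]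
  · simp only [Finset.mem_filter, Finset.mem_Icc] at hk
    exact subset_convexHull ℝ S (hS k hk.1.1 hk.1.2 hk.2)

lemma sum_ite_stdC {n c : ℕ} (hc : 1 ≤ c) (hcn : c ≤ n) (P : ℕ → Prop) [DecidablePred P] :
    ∑ l : Fin n, (if P (l + 1) then stdC n c l else 0) = if P c then 1 else 0 := by
  rw [Finset.sum_eq_single (⟨c - 1, by omega⟩ : Fin n)]
  · simp [stdC, Nat.sub_add_cancel hc]
  · intro l _ hl
    have : (l : ℕ) + 1 ≠ c := fun h => hl (Fin.ext (by simp only; omega))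
    simp [stdC, this]
  · simp

lemma sum_ite_eq_min {ι : Type*} {s : Finset ι} {w : ι → ℝ} (hw : ∀ k, 0 ≤ w k)
    (hs : ∑ k ∈ s, w k = 1) (P Q : ι → Prop) [DecidablePred P] [DecidablePred Q]
    (h : (∀ k ∈ s, P k) ∨ ∀ k ∈ s, ¬ Q k) :
    ∑ k ∈ s, (if P k then w k else 0) =
      min 1 (∑ k ∈ s, w k * ((if P k then 1 else 0) + if Q k then 1 else 0)) := by
  rcases h with h | h
  · rw [Finset.sum_congr rfl fun k hk => if_pos (h k hk), hs, min_eq_left]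
    refine hs.ge.trans (Finset.sum_le_sum fun k hk => ?_)
    rw [if_pos (h k hk)]
    have := hw k
    split_ifs <;> linarith
  · have hsum : ∑ k ∈ s, w k * ((if P k then 1 else 0) + if Q k then 1 else 0) =
        ∑ k ∈ s, (if P k then w k else 0) :=
      Finset.sum_congr rfl fun k hk => by simp [h k hk]
    rw [hsum, min_eq_right]
    rw [← hs]
    refine Finset.sum_le_sum fun k _ => ?_
    have := hw k
    split_ifs <;> linarith

namespace IsPathWeight

variable {n : ℕ} {a b : ℕ → ℕ} {x : Fin n → ℝ} {w : ℕ → ℝ}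

lemma sum_ite (h : IsStairC n a b) (hw : IsPathWeight n a b x w) (P : ℕ → Prop)
    [DecidablePred P] :
    ∑ l : Fin n, (if P (l + 1) then x l else 0) =
      ∑ k ∈ Finset.Icc 1 n, w k * ((if P (a k) then 1 else 0) + if P (b k) then 1 else 0) := by
  have hl : ∀ l : Fin n, (if P (l + 1) then x l else 0) = ∑ k ∈ Finset.Icc 1 n,
      w k * ((if P (l + 1) then stdC n (a k) l else 0) +
        if P (l + 1) then stdC n (b k) l else 0) := by
    intro l
    rw [hw.eq_sum]
    split_ifs <;> simp [mul_add]
  simp_rw [hl]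
  rw [Finset.sum_comm]
  refine Finset.sum_congr rfl fun k hk => ?_
  rw [Finset.mem_Icc] at hk
  obtain ⟨h₁, h₂, h₃⟩ := h.bounds hk.1 hk.2
  rw [← Finset.mul_sum, Finset.sum_add_distrib, sum_ite_stdC h₁ (h₂.trans h₃) P,
    sum_ite_stdC (h₁.trans h₂) h₃ P]

/-- The mass of the initial segment `a ≤ i` of a path depends only on the point `x`. -/
lemma sum_left (h : IsStairC n a b) (hw : IsPathWeight n a b x w) (i : ℕ) :
    ∑ k ∈ Finset.Icc 1 n, (if a k ≤ i then w k else 0) =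
      min 1 (∑ l : Fin n, if (l : ℕ) + 1 ≤ i then x l else 0) := by
  rw [hw.sum_ite h (· ≤ i)]
  refine sum_ite_eq_min hw.nonneg hw.sum_eq_one (a · ≤ i) (b · ≤ i) ?_
  by_contra! hcon
  obtain ⟨⟨k, hk, hki⟩, l, hl, hli⟩ := hcon
  rw [Finset.mem_Icc] at hk hl
  have := h.left_le_right hk.1 hk.2 hl.1 hl.2
  omega

/-- The mass of the initial segment `j ≤ b` of a path depends only on the point `x`. -/
lemma sum_right (h : IsStairC n a b) (hw : IsPathWeight n a b x w) (j : ℕ) :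
    ∑ k ∈ Finset.Icc 1 n, (if j ≤ b k then w k else 0) =
      min 1 (∑ l : Fin n, if j ≤ (l : ℕ) + 1 then x l else 0) := by
  rw [hw.sum_ite h (j ≤ ·)]
  simp_rw [add_comm (if j ≤ a _ then (1 : ℝ) else 0)]
  refine sum_ite_eq_min hw.nonneg hw.sum_eq_one (j ≤ b ·) (j ≤ a ·) ?_
  by_contra! hcon
  obtain ⟨⟨k, hk, hki⟩, l, hl, hli⟩ := hcon
  rw [Finset.mem_Icc] at hk hl
  have := h.left_le_right hl.1 hl.2 hk.1 hk.2
  omega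

end IsPathWeight

lemma sum_ite_le_sum_ite {ι : Type*} {s : Finset ι} {w : ι → ℝ} (hw : ∀ k, 0 ≤ w k)
    {P Q : ι → Prop} [DecidablePred P] [DecidablePred Q] (h : ∀ k ∈ s, P k → Q k) :
    ∑ k ∈ s, (if P k then w k else 0) ≤ ∑ k ∈ s, (if Q k then w k else 0) := by
  refine Finset.sum_le_sum fun k hk => ?_
  by_cases hP : P k
  · rw [if_pos hP, if_pos (h k hk hP)]
  · rw [if_neg hP]
    split_ifs
    exacts [hw k, le_rfl]

lemma sum_ite_add_le_sum_ite {ι : Type*} [DecidableEq ι] {s : Finset ι} {w : ι → ℝ}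
    (hw : ∀ k, 0 ≤ w k) {P Q : ι → Prop} [DecidablePred P] [DecidablePred Q] {m : ι}
    (hm : m ∈ s) (hP : ¬ P m) (hQ : Q m) (h : ∀ k ∈ s, P k → Q k) :
    ∑ k ∈ s, (if P k then w k else 0) + w m ≤ ∑ k ∈ s, (if Q k then w k else 0) := by
  have hle := sum_ite_le_sum_ite (s := s.erase m) hw
    fun k hk => h k (Finset.mem_of_mem_erase hk)
  rw [← Finset.add_sum_erase s _ hm, ← Finset.add_sum_erase s (fun k => if Q k then w k else 0) hm,
    if_neg hP, if_pos hQ]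
  linarith

lemma IsPathWeight.eq_zero_of_ne {n : ℕ} {a b a' b' : ℕ → ℕ} {x : Fin n → ℝ} {w w' : ℕ → ℝ}
    (h : IsStairC n a b) (h' : IsStairC n a' b') (hw : IsPathWeight n a b x w)
    (hw' : IsPathWeight n a' b' x w') {k : ℕ} (hk : 1 ≤ k) (hkn : k ≤ n)
    (hne : ¬ (a' k = a k ∧ b' k = b k)) : w k = 0 := by
  refine le_antisymm ?_ (hw.nonneg k)
  have hsum := h.add_eq hk hkn
  have hsum' := h'.add_eq hk hkn
  have hmem : k ∈ Finset.Icc 1 n := Finset.mem_Icc.2 ⟨hk, hkn⟩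
  have hb := h.bounds hk hkn
  rcases lt_or_ge (a k) (a' k) with hlt | hge
  · have h₁ := sum_ite_le_sum_ite (s := Finset.Icc 1 n) hw'.nonneg
      (P := (a' · ≤ a k)) (Q := (b k + 1 ≤ b' ·)) fun l hl hP => by
        rw [Finset.mem_Icc] at hl
        rcases le_total k l with hkl | hkl
        · have := h'.mono hk hkl hl.2
          omega
        · have := h'.mono hl.1 hkl hkn
          omega
    have h₂ := sum_ite_add_le_sum_ite hw.nonneg
      (P := (b k + 1 ≤ b ·)) (Q := (a · ≤ a k)) hmem (by omega) le_rfl fun l hl hP => by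
        rw [Finset.mem_Icc] at hl
        rcases le_total k l with hkl | hkl
        · have := h.mono hk hkl hl.2
          omega
        · exact (h.mono hl.1 hkl hkn).1
    rw [hw.sum_left h, hw.sum_right h] at h₂
    rw [hw'.sum_left h', hw'.sum_right h'] at h₁
    linarith
  · have h₁ := sum_ite_le_sum_ite (s := Finset.Icc 1 n) hw'.nonneg
      (P := (b k ≤ b' ·)) (Q := (a' · ≤ a k - 1)) fun l hl hP => by
        rw [Finset.mem_Icc] at hl
        rcases le_total k l with hkl | hkl
        · have := h'.mono hk hkl hl.2
          omega
        · have := h'.mono hl.1 hkl hkn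
          omega
    have h₂ := sum_ite_add_le_sum_ite hw.nonneg
      (P := (a · ≤ a k - 1)) (Q := (b k ≤ b ·)) hmem (by omega) le_rfl fun l hl hP => by
        rw [Finset.mem_Icc] at hl
        rcases le_total k l with hkl | hkl
        · have := h.mono hk hkl hl.2
          omega
        · exact (h.mono hl.1 hkl hkn).2
    rw [hw.sum_left h, hw.sum_right h] at h₂
    rw [hw'.sum_left h', hw'.sum_right h'] at h₁
    linarith

/-- A nonnegative vector supported on the coordinates `i, …, i + d` lies in the cone spanned by
the roots of some staircase from `(i, i + d)` to the diagonal. -/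
lemma exists_staircase_cone (n d : ℕ) : ∀ (i : ℕ) (y : Fin n → ℝ), (∀ l, 0 ≤ y l) →
    (∀ l : Fin n, y l ≠ 0 → i ≤ (l : ℕ) + 1 ∧ (l : ℕ) + 1 ≤ i + d) → 1 ≤ i → i + d ≤ n →
    ∃ (a b : ℕ → ℕ) (w : ℕ → ℝ), a 0 = i ∧ b 0 = i + d ∧
      (∀ k < d, (a (k + 1) = a k + 1 ∧ b (k + 1) = b k) ∨
        (a (k + 1) = a k ∧ b k = b (k + 1) + 1)) ∧
      (∀ k, 0 ≤ w k) ∧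
      y = ∑ k ∈ Finset.range (d + 1), w k • (stdC n (a k) + stdC n (b k)) := by
  induction d with
  | zero =>
    intro i y hy hsupp hi hin
    refine ⟨fun _ => i, fun _ => i, fun _ => y ⟨i - 1, by omega⟩ / 2, rfl, rfl, by simp,
      fun _ => div_nonneg (hy _) two_pos.le, ?_⟩
    ext l
    simp only [zero_add, Finset.range_one, Finset.sum_singleton, Pi.smul_apply, Pi.add_apply,
      smul_eq_mul, stdC]
    by_cases hl : (l : ℕ) + 1 = i
    · have : l = ⟨i - 1, by omega⟩ := Fin.ext (by simp only; omega)
      rw [if_pos hl, ← this]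
      ring
    · rw [if_neg hl]
      by_contra hne
      have := hsupp l (by simpa using hne)
      omega
  | succ d ih =>
    intro i y hy hsupp hi hin
    set p : Fin n := ⟨i - 1, by omega⟩ with hp
    set q : Fin n := ⟨i + d, by omega⟩ with hq
    set m := min (y p) (y q) with hm
    have hm0 : 0 ≤ m := le_min (hy _) (hy _)
    have hmp : m ≤ y p := min_le_left _ _
    have hmq : m ≤ y q := min_le_right _ _
    have key : ∀ l : Fin n, ((l : ℕ) + 1 = i ∧ l = p ∧ l ≠ q) ∨
        ((l : ℕ) + 1 = i + (d + 1) ∧ l = q ∧ l ≠ p) ∨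
        ((l : ℕ) + 1 ≠ i ∧ (l : ℕ) + 1 ≠ i + (d + 1) ∧ l ≠ p ∧ l ≠ q) := by
      intro l
      simp only [hp, hq, Fin.ext_iff, ne_eq]
      omega
    set z : Fin n → ℝ := y - m • (stdC n i + stdC n (i + (d + 1))) with hz
    have hzp : z p = y p - m := by
      have h₁ : (p : ℕ) + 1 = i := by simp only [hp]; omega
      simp [hz, stdC, h₁]
    have hzq : z q = y q - m := by
      have h₁ : (q : ℕ) + 1 = i + (d + 1) := by simp only [hq]; omega
      simp [hz, stdC, h₁]
    have hzl : ∀ l : Fin n, l ≠ p → l ≠ q → z l = y l := by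
      intro l h₁ h₂
      rcases key l with h | h | h
      · exact absurd h.2.1 h₁
      · exact absurd h.2.1 h₂
      · simp [hz, stdC, h.1, h.2.1]
    have hz0 : ∀ l, 0 ≤ z l := by
      intro l
      rcases key l with h | h | h
      · rw [h.2.1, hzp]; linarith
      · rw [h.2.1, hzq]; linarith
      · rw [hzl l h.2.2.1 h.2.2.2]; exact hy l
    have hyz : y = m • (stdC n i + stdC n (i + (d + 1))) + z := by simp [hz]
    have step : ∀ i' : ℕ, ((i' = i + 1 ∧ i' + d = i + (d + 1)) ∨
        (i' = i ∧ i + (d + 1) = i' + d + 1)) →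
        (∀ l : Fin n, z l ≠ 0 → i' ≤ (l : ℕ) + 1 ∧ (l : ℕ) + 1 ≤ i' + d) →
        ∃ (a b : ℕ → ℕ) (w : ℕ → ℝ), a 0 = i ∧ b 0 = i + (d + 1) ∧
          (∀ k < d + 1, (a (k + 1) = a k + 1 ∧ b (k + 1) = b k) ∨
            (a (k + 1) = a k ∧ b k = b (k + 1) + 1)) ∧
          (∀ k, 0 ≤ w k) ∧
          y = ∑ k ∈ Finset.range (d + 1 + 1), w k • (stdC n (a k) + stdC n (b k)) := by
      intro i' hi' hsupp'
      obtain ⟨a, b, w, ha, hb, hab, hw, hsum⟩ := ih i' z hz0 hsupp' (by omega) (by omega)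
      refine ⟨fun k => Nat.casesOn k i a, fun k => Nat.casesOn k (i + (d + 1)) b,
        fun k => Nat.casesOn k m w, rfl, rfl, ?_, ?_, ?_⟩
      · rintro (_ | k) hk
        · simp only [ha, hb]
          exact hi'
        · exact hab k (by omega)
      · rintro (_ | k)
        exacts [hm0, hw k]
      · rw [Finset.sum_range_succ', add_comm]
        simp only
        rw [← hsum]
        exact hyz
    rcases le_total (y p) (y q) with hle | hle
    · have hmin : m = y p := min_eq_left hle
      refine step (i + 1) (Or.inl ⟨rfl, by omega⟩) fun l hl => ?_
      rcases key l with h | h | h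
      · rw [h.2.1, hzp, hmin, sub_self] at hl
        exact absurd rfl hl
      · omega
      · rw [hzl l h.2.2.1 h.2.2.2] at hl
        have := hsupp l hl
        omega
    · have hmin : m = y q := min_eq_right hle
      refine step i (Or.inr ⟨rfl, by omega⟩) fun l hl => ?_
      rcases key l with h | h | h
      · omega
      · rw [h.2.1, hzq, hmin, sub_self] at hl
        exact absurd rfl hl
      · rw [hzl l h.2.2.1 h.2.2.2] at hl
        have := hsupp l hl
        omega

lemma sum_stdC {n c : ℕ} (hc : 1 ≤ c) (hcn : c ≤ n) : ∑ l, stdC n c l = 1 := by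
  simpa using sum_ite_stdC hc hcn fun _ => True

lemma exists_isStairC_mem_convexHull {n : ℕ} (hn : 1 ≤ n) {x : Fin n → ℝ} (hx : ∀ l, 0 ≤ x l)
    (hsum : ∑ l, x l = 2) : ∃ a b, IsStairC n a b ∧ x ∈ convexHull ℝ (RsetC n a b) := by
  obtain ⟨a, b, w, ha, hb, hab, hw, hxw⟩ := exists_staircase_cone n (n - 1) 1 x hx
    (fun l _ => by omega) le_rfl (by omega)
  have hstair : IsStairC n (fun k => a (k - 1)) fun k => b (k - 1) := by
    refine ⟨ha, hb.trans (by omega), fun k hk hkn => ?_⟩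
    obtain ⟨k, rfl⟩ := Nat.exists_eq_add_of_le' hk
    exact hab k (by omega)
  have hshift : ∀ {E : Type} [AddCommMonoid E] (f : ℕ → E),
      ∑ k ∈ Finset.range (n - 1 + 1), f k = ∑ k ∈ Finset.Icc 1 n, f (k - 1) := by
    intro E _ f
    rw [Nat.sub_add_cancel hn, ← Finset.Ico_add_one_right_eq_Icc, Finset.sum_Ico_eq_sum_range]
    simp
  rw [hshift] at hxw
  refine ⟨_, _, hstair, IsPathWeight.mem_convexHull (w := fun k => w (k - 1))
    ⟨fun k => hw _, ?_, hxw⟩ fun k hk hkn _ => ⟨k, hk, hkn, rfl⟩⟩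
  have htotal : ∑ l, x l = ∑ k ∈ Finset.Icc 1 n, w (k - 1) * 2 := by
    rw [hxw]
    simp only [Finset.sum_apply, Pi.smul_apply, Pi.add_apply, smul_eq_mul]
    rw [Finset.sum_comm]
    refine Finset.sum_congr rfl fun k hk => ?_
    rw [Finset.mem_Icc] at hk
    obtain ⟨h₁, h₂, h₃⟩ := hstair.bounds hk.1 hk.2
    rw [← Finset.mul_sum, Finset.sum_add_distrib, sum_stdC h₁ (h₂.trans h₃),
      sum_stdC (h₁.trans h₂) h₃]
    norm_num
  rw [hsum, ← Finset.sum_mul] at htotal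
  linarith

/-- Type C_n: the convex hulls of the root sets of the staircase paths form a
triangulation of the unique standard parabolic facet conv(M). -/
theorem typeC_staircase_triangulation_of_facet (n : ℕ) (hn : 1 ≤ n)
    (M : Set (Fin n → ℝ))
    (hM : M = {v | ∃ a b : ℕ, 1 ≤ a ∧ a ≤ b ∧ b ≤ n ∧ v = stdC n a + stdC n b}) :
    (convexHull ℝ M
        = convexHull ℝ {v | ∃ j : ℕ, 1 ≤ j ∧ j ≤ n ∧ v = (2 : ℝ) • stdC n j}) ∧
    (convexHull ℝ M
        = {x | ∃ a b : ℕ → ℕ, IsStairC n a b ∧ x ∈ convexHull ℝ (RsetC n a b)}) ∧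
    (∀ pa pb qa qb : ℕ → ℕ, IsStairC n pa pb → IsStairC n qa qb →
      convexHull ℝ (RsetC n pa pb) ∩ convexHull ℝ (RsetC n qa qb)
        = convexHull ℝ (RsetC n pa pb ∩ RsetC n qa qb)) := by
  subst hM
  have hle : ∀ v ∈ convexHull ℝ {v | ∃ a b : ℕ, 1 ≤ a ∧ a ≤ b ∧ b ≤ n ∧
      v = stdC n a + stdC n b}, (∀ l, 0 ≤ v l) ∧ ∑ l, v l = 2 := by
    refine convexHull_min (t := {v : Fin n → ℝ | (∀ l, 0 ≤ v l) ∧ ∑ l, v l = 2}) ?_ ?_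
    · rintro v ⟨a, b, ha, hab, hb, rfl⟩
      refine ⟨fun l => ?_, ?_⟩
      · simp only [Pi.add_apply, stdC]
        positivity
      · simp only [Pi.add_apply, Finset.sum_add_distrib]
        rw [sum_stdC ha (hab.trans hb), sum_stdC (ha.trans hab) hb]
        norm_num
    · rintro v ⟨hv, hv'⟩ u ⟨hu, hu'⟩ s t hs ht hst
      refine ⟨fun l => ?_, ?_⟩
      · exact add_nonneg (mul_nonneg hs (hv l)) (mul_nonneg ht (hu l))
      · simp only [Pi.add_apply, Pi.smul_apply, smul_eq_mul, Finset.sum_add_distrib,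
          ← Finset.mul_sum]
        rw [hv', hu', ← add_mul, hst, one_mul]
  refine ⟨Set.Subset.antisymm (convexHull_min ?_ (convex_convexHull ℝ _))
    (convexHull_mono ?_), Set.Subset.antisymm ?_ ?_, ?_⟩
  · rintro v ⟨a, b, ha, hab, hb, rfl⟩
    have hv : stdC n a + stdC n b =
        (1 / 2 : ℝ) • ((2 : ℝ) • stdC n a) + (1 / 2 : ℝ) • ((2 : ℝ) • stdC n b) := by
      simp [smul_smul]
    rw [hv]
    refine convex_convexHull ℝ _ (subset_convexHull ℝ _ ?_) (subset_convexHull ℝ _ ?_)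
      (by norm_num) (by norm_num) (by norm_num)
    exacts [⟨a, ha, hab.trans hb, rfl⟩, ⟨b, ha.trans hab, hb, rfl⟩]
  · rintro v ⟨j, hj, hjn, rfl⟩
    exact ⟨j, j, hj, le_rfl, hjn, two_smul ℝ _⟩
  · intro x hx
    exact exists_isStairC_mem_convexHull hn (hle x hx).1 (hle x hx).2
  · rintro x ⟨a, b, hab, hx⟩
    refine convexHull_mono ?_ hx
    rintro v ⟨k, hk, hkn, rfl⟩
    obtain ⟨h₁, h₂, h₃⟩ := hab.bounds hk hkn
    exact ⟨a k, b k, h₁, h₂, h₃, rfl⟩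
  · intro pa pb qa qb hp hq
    refine Set.Subset.antisymm ?_ (Set.subset_inter (convexHull_mono Set.inter_subset_left)
      (convexHull_mono Set.inter_subset_right))
    rintro x ⟨hxp, hxq⟩
    obtain ⟨w, hw⟩ := exists_isPathWeight hxp
    obtain ⟨w', hw'⟩ := exists_isPathWeight hxq
    refine hw.mem_convexHull fun k hk hkn hne => ⟨⟨k, hk, hkn, rfl⟩, k, hk, hkn, ?_⟩
    by_contra hroot
    refine hne (hw.eq_zero_of_ne hp hq hw' hk hkn fun h => hroot ?_)
    rw [h.1, h.2]
end

section
/- Let n ≥ 2, fix i ∈ [n], and consider the type A_n setting in ℝ^{n+1} with highest root θ = e_1 − e_{n+1} and M_i = {e_a − e_b : 1 ≤ a ≤ i < b ≤ n+1}. Let I be a dual order ideal of Φ⁺ with I ⊆ M_i. Then the following are equivalent: (1) for all β, γ ∈ Φ⁺ with β + γ = θ, exactly one of β, γ belongs to I; (2) both e_1 − e_{i+1} ∈ I and e_i − e_{n+1} ∈ I. (This characterizes the abelian ideals belonging to 𝓘_ab(α_i) in type A_n.) -/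
theorem stdA_apply (n a p : ℕ) (hp1 : 1 ≤ p) (hpn : p ≤ n + 1) :
    stdA n a ⟨p - 1, by omega⟩ = if p = a then 1 else 0 := by
  simp [stdA, Nat.sub_add_cancel hp1]

theorem stdA_sub_injective {n a b c d : ℕ} (ha : 1 ≤ a) (hab : a < b) (hb : b ≤ n + 1)
    (h : stdA n a - stdA n b = stdA n c - stdA n d) : a = c ∧ b = d := by
  have key (p : ℕ) (hp1 : 1 ≤ p) (hpn : p ≤ n + 1) :
      ((if p = a then 1 else 0) - (if p = b then 1 else 0) : ℝ) =
        (if p = c then 1 else 0) - (if p = d then 1 else 0) := by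
    simpa only [Pi.sub_apply, stdA_apply n _ p hp1 hpn] using congrFun h ⟨p - 1, by omega⟩
  have h1 := key a ha (by omega)
  have h2 := key b (by omega) hb
  constructor
  · by_contra hac
    rw [if_pos rfl, if_neg hab.ne, if_neg hac] at h1
    split_ifs at h1 <;> norm_num at h1
  · by_contra hbd
    rw [if_pos rfl, if_neg hab.ne', if_neg hbd] at h2
    split_ifs at h2 <;> norm_num at h2

theorem stdA_sub_eq_sum_simple {n a b : ℕ} (ha : 1 ≤ a) (hab : a ≤ b) (hb : b ≤ n + 1) :
    ∃ c : ℕ → ℕ, stdA n a - stdA n b =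
      ∑ k ∈ Finset.Icc 1 n, (c k : ℝ) • (stdA n k - stdA n (k + 1)) := by
  refine ⟨fun k => if k ∈ Finset.Ico a b then 1 else 0, ?_⟩
  have hsub : Finset.Ico a b ⊆ Finset.Icc 1 n := by
    intro k hk
    simp only [Finset.mem_Ico, Finset.mem_Icc] at hk ⊢
    omega
  simp only [Nat.cast_ite, Nat.cast_one, Nat.cast_zero, ite_smul, one_smul, zero_smul]
  rw [Finset.sum_ite_mem, Finset.inter_eq_right.mpr hsub, ← neg_sub (stdA n b),
    ← Finset.sum_Ico_sub (stdA n) hab, ← Finset.sum_neg_distrib]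
  simp only [neg_sub]

theorem stdA_sub_add_sub_eq_highest {n a b c d : ℕ} (ha : 1 ≤ a) (hab : a < b)
    (hb : b ≤ n + 1) (hc : 1 ≤ c) (hcd : c < d) (hd : d ≤ n + 1)
    (h : (stdA n a - stdA n b) + (stdA n c - stdA n d) = stdA n 1 - stdA n (n + 1)) :
    (a = 1 ∧ b = c ∧ d = n + 1) ∨ (c = 1 ∧ d = a ∧ b = n + 1) := by
  have key (p : ℕ) (hp1 : 1 ≤ p) (hpn : p ≤ n + 1) :
      ((if p = a then 1 else 0) - (if p = b then 1 else 0) +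
        ((if p = c then 1 else 0) - (if p = d then 1 else 0)) : ℝ) =
        (if p = 1 then 1 else 0) - (if p = n + 1 then 1 else 0) := by
    simpa only [Pi.sub_apply, Pi.add_apply, stdA_apply n _ p hp1 hpn] using
      congrFun h ⟨p - 1, by omega⟩
  have h1 := key 1 le_rfl (by omega)
  have hkb := key b (by omega) hb
  have hkd := key d (by omega) hd
  grind

/-- Type A_n: a dual order ideal I ⊆ M_i belongs to 𝓘_ab(α_i) — that is, each
decomposition θ = β + γ of the highest root has exactly one summand in I — if and only if
both α_{1,i} = e_1 − e_{i+1} and α_{i,n} = e_i − e_{n+1} belong to I. -/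
theorem typeA_Iab_characterization (n i : ℕ)
    (hn : 2 ≤ n) (hi1 : 1 ≤ i) (hin : i ≤ n)
    (Φpos : Set (Fin (n+1) → ℝ))
    (hΦpos : Φpos = {v | ∃ a b : ℕ, 1 ≤ a ∧ a < b ∧ b ≤ n + 1 ∧ v = stdA n a - stdA n b})
    (rle : (Fin (n+1) → ℝ) → (Fin (n+1) → ℝ) → Prop)
    (hrle : ∀ β γ, rle β γ ↔ ∃ c : ℕ → ℕ,
        γ - β = ∑ k ∈ Finset.Icc 1 n, (c k : ℝ) • (stdA n k - stdA n (k+1)))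
    (Mi : Set (Fin (n+1) → ℝ))
    (hMi : Mi = {v | ∃ a b : ℕ, 1 ≤ a ∧ a ≤ i ∧ i < b ∧ b ≤ n + 1 ∧
        v = stdA n a - stdA n b})
    (θ : Fin (n+1) → ℝ) (hθ : θ = stdA n 1 - stdA n (n+1))
    (I : Set (Fin (n+1) → ℝ)) (hIM : I ⊆ Mi)
    (hIideal : ∀ β ∈ I, ∀ γ ∈ Φpos, rle β γ → γ ∈ I) :
    (∀ β ∈ Φpos, ∀ γ ∈ Φpos, β + γ = θ →
        ((β ∈ I ∧ γ ∉ I) ∨ (β ∉ I ∧ γ ∈ I))) ↔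
      (stdA n 1 - stdA n (i+1) ∈ I ∧ stdA n i - stdA n (n+1) ∈ I) := by
  subst hΦpos hMi hθ
  have hnot {a b : ℕ} (ha : 1 ≤ a) (hab : a < b) (hb : b ≤ n + 1) (hi : i < a ∨ b ≤ i) :
      stdA n a - stdA n b ∉ I := by
    intro hI
    obtain ⟨c, d, -, hci, hid, -, h⟩ := hIM hI
    obtain ⟨rfl, rfl⟩ := stdA_sub_injective ha hab hb h
    omega
  have hright {a b b' : ℕ} (ha : 1 ≤ a) (hab : a < b) (hbb : b ≤ b') (hb : b' ≤ n + 1)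
      (hI : stdA n a - stdA n b ∈ I) : stdA n a - stdA n b' ∈ I := by
    refine hIideal _ hI _ ⟨a, b', ha, by omega, hb, rfl⟩ ((hrle _ _).mpr ?_)
    rw [sub_sub_sub_cancel_left]
    exact stdA_sub_eq_sum_simple (by omega) hbb hb
  have hleft {a a' b : ℕ} (ha : 1 ≤ a') (haa : a' ≤ a) (hab : a < b) (hb : b ≤ n + 1)
      (hI : stdA n a - stdA n b ∈ I) : stdA n a' - stdA n b ∈ I := by
    refine hIideal _ hI _ ⟨a', b, ha, by omega, hb, rfl⟩ ((hrle _ _).mpr ?_)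
    rw [sub_sub_sub_cancel_right]
    exact stdA_sub_eq_sum_simple ha haa (by omega)
  constructor
  · intro h
    have split (k : ℕ) (hk : 1 < k) (hkn : k ≤ n) :=
      h _ ⟨1, k, le_rfl, hk, by omega, rfl⟩ _ ⟨k, n + 1, by omega, by omega, le_rfl, rfl⟩
        (sub_add_sub_cancel _ _ _)
    have hfst (hlt : i < n) : stdA n 1 - stdA n (i + 1) ∈ I := by
      have := hnot (a := i + 1) (b := n + 1) (by omega) (by omega) le_rfl (by omega)
      have := split (i + 1) (by omega) hlt
      tauto
    have hsnd (hlt : 1 < i) : stdA n i - stdA n (n + 1) ∈ I := by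
      have := hnot (a := 1) (b := i) le_rfl hlt (by omega) (by omega)
      have := split i hlt hin
      tauto
    constructor
    · rcases hin.lt_or_eq with hlt | rfl
      · exact hfst hlt
      · exact hleft le_rfl hi1 (by omega) le_rfl (hsnd (by omega))
    · rcases hi1.lt_or_eq with hlt | rfl
      · exact hsnd hlt
      · exact hright le_rfl (by omega) (by omega) le_rfl (hfst (by omega))
  · rintro ⟨hfst, hsnd⟩
    have split (k : ℕ) (hk : 1 < k) (hkn : k < n + 1) :
        (stdA n 1 - stdA n k ∈ I ∧ stdA n k - stdA n (n + 1) ∉ I) ∨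
          (stdA n 1 - stdA n k ∉ I ∧ stdA n k - stdA n (n + 1) ∈ I) := by
      rcases lt_or_ge i k with hik | hki
      · exact .inl ⟨hright le_rfl (by omega) hik (by omega) hfst,
          hnot (by omega) hkn le_rfl (.inl hik)⟩
      · exact .inr ⟨hnot le_rfl hk (by omega) (.inr hki),
          hleft (by omega) hki (by omega) le_rfl hsnd⟩
    rintro _ ⟨a, b, ha, hab, hb, rfl⟩ _ ⟨c, d, hc, hcd, hd, rfl⟩ h
    obtain ⟨rfl, rfl, rfl⟩ | ⟨rfl, rfl, rfl⟩ :=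
      stdA_sub_add_sub_eq_highest ha hab hb hc hcd hd h
    · exact split b hab hcd
    · have := split d hcd hab
      tauto
end

section
/- Let n ≥ 2 and consider the type C_n setting in ℝ^n with highest root θ = 2e_1. Let I be an abelian dual order ideal of Φ⁺. Then the following are equivalent: (1) for all β, γ ∈ Φ⁺ with β + γ = θ, exactly one of β, γ belongs to I; (2) e_1 + e_n ∈ I. (This characterizes the abelian ideals belonging to 𝓘_ab(α_n) in type C_n.) -/
theorem sum_indicator_smul_sub {M : Type*} [AddCommGroup M] [Module ℝ M] (f : ℕ → M)
    {j n : ℕ} (hj : 1 ≤ j) (hjn : j ≤ n) :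
    ∑ k ∈ Finset.Icc 1 (n - 1), ((if j ≤ k ∧ k < n then 1 else 0 : ℕ) : ℝ) • (f k - f (k + 1))
      = f j - f n := by
  have hfilter : (Finset.Icc 1 (n - 1)).filter (fun k => j ≤ k ∧ k < n) = Finset.Ico j n := by
    ext k
    simp only [Finset.mem_filter, Finset.mem_Icc, Finset.mem_Ico]
    omega
  have hterm : ∀ k, ((if j ≤ k ∧ k < n then 1 else 0 : ℕ) : ℝ) • (f k - f (k + 1))
      = if j ≤ k ∧ k < n then f k - f (k + 1) else 0 := by
    intro k
    split_ifs <;> simp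
  rw [Finset.sum_congr rfl fun k _ => hterm k, ← Finset.sum_filter, hfilter]
  clear hfilter hterm
  induction n, hjn using Nat.le_induction with
  | base => simp
  | succ m hm ih =>
    rw [Finset.sum_Ico_succ_top hm, ih]
    abel

/-- If two positive roots of type C_n add up to `2e_1`, one of them is `e_1 + e_j` for some `j`. -/
theorem exists_eq_stdC_one_add_of_add_eq {n : ℕ} (hn : 2 ≤ n) {β γ : Fin n → ℝ}
    (hβ : ∃ a b : ℕ, 1 ≤ a ∧ b ≤ n ∧
      ((a < b ∧ β = stdC n a - stdC n b) ∨ (a ≤ b ∧ β = stdC n a + stdC n b)))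
    (hγ : ∃ a b : ℕ, 1 ≤ a ∧ b ≤ n ∧
      ((a < b ∧ γ = stdC n a - stdC n b) ∨ (a ≤ b ∧ γ = stdC n a + stdC n b)))
    (h : β + γ = (2 : ℝ) • stdC n 1) :
    ∃ j, 1 ≤ j ∧ j ≤ n ∧ (β = stdC n 1 + stdC n j ∨ γ = stdC n 1 + stdC n j) := by
  obtain ⟨a, b, ha, hb, hβ⟩ := hβ
  obtain ⟨c, d, hc, hd, hγ⟩ := hγ
  by_cases hβ' : a ≤ b ∧ a = 1 ∧ β = stdC n a + stdC n b
  · obtain ⟨hab, rfl, hβ'⟩ := hβ'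
    exact ⟨b, hab, hb, Or.inl hβ'⟩
  by_cases hγ' : c ≤ d ∧ c = 1 ∧ γ = stdC n c + stdC n d
  · obtain ⟨hcd, rfl, hγ'⟩ := hγ'
    exact ⟨d, hcd, hd, Or.inr hγ'⟩
  exfalso
  have hfirst := congrFun h ⟨0, by omega⟩
  rcases hβ with ⟨hab, hβ⟩ | ⟨hab, hβ⟩ <;> rcases hγ with ⟨hcd, hγ⟩ | ⟨hcd, hγ⟩
  · have hsum : ∀ k, 1 ≤ k → k ≤ n → ∑ i, stdC n k i = 1 := by
      intro k hk hkn
      rw [Finset.sum_eq_single (⟨k - 1, by omega⟩ : Fin n)]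
      · simp only [stdC]
        rw [if_pos (by omega)]
      · intro i _ hi
        simp only [stdC]
        rw [if_neg]
        intro hik
        exact hi (Fin.ext (by simp only; omega))
      · simp
    have htotal := congrArg (fun v : Fin n → ℝ => ∑ i, v i) h
    simp only [hβ, hγ, Pi.add_apply, Pi.sub_apply, Pi.smul_apply, smul_eq_mul,
      Finset.sum_add_distrib, Finset.sum_sub_distrib, ← Finset.mul_sum] at htotal
    rw [hsum a (by omega) (by omega), hsum b (by omega) (by omega), hsum c (by omega) (by omega),
      hsum d (by omega) (by omega), hsum 1 (by omega) (by omega)] at htotal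
    norm_num at htotal
  all_goals
    simp only [hβ, hγ, Pi.add_apply, Pi.sub_apply, Pi.smul_apply, smul_eq_mul, stdC] at hfirst
    split_ifs at hfirst <;> first | omega | (norm_num at hfirst; done) | grind

/-- Type C_n: an abelian dual order ideal I of Φ⁺ belongs to 𝓘_ab(α_n) — that is, each
decomposition θ = β + γ of the highest root θ = 2e_1 has exactly one summand in I —
if and only if e_1 + e_n ∈ I. -/
theorem typeC_Iab_characterization (n : ℕ) (hn : 2 ≤ n)
    (Φ : Set (Fin n → ℝ))
    (hΦ : Φ = {v | (∃ a b : ℕ, 1 ≤ a ∧ a < b ∧ b ≤ n ∧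
          (v = stdC n a + stdC n b ∨ v = stdC n a - stdC n b ∨
           v = -stdC n a + stdC n b ∨ v = -stdC n a - stdC n b)) ∨
        (∃ a : ℕ, 1 ≤ a ∧ a ≤ n ∧
          (v = (2 : ℝ) • stdC n a ∨ v = -((2 : ℝ) • stdC n a)))})
    (Φpos : Set (Fin n → ℝ))
    (hΦpos : Φpos = {v | ∃ a b : ℕ, 1 ≤ a ∧ b ≤ n ∧
        ((a < b ∧ v = stdC n a - stdC n b) ∨ (a ≤ b ∧ v = stdC n a + stdC n b))})
    (rle : (Fin n → ℝ) → (Fin n → ℝ) → Prop)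
    (hrle : ∀ β γ, rle β γ ↔ ∃ c : ℕ → ℕ,
        γ - β = (∑ k ∈ Finset.Icc 1 (n-1), (c k : ℝ) • (stdC n k - stdC n (k+1)))
          + (c n : ℝ) • ((2 : ℝ) • stdC n n))
    (θ : Fin n → ℝ) (hθ : θ = (2 : ℝ) • stdC n 1)
    (I : Set (Fin n → ℝ)) (hIΦ : I ⊆ Φpos)
    (hIideal : ∀ β ∈ I, ∀ γ ∈ Φpos, rle β γ → γ ∈ I)
    (hIab : ∀ β ∈ I, ∀ γ ∈ I, β + γ ∉ Φ) :
    (∀ β ∈ Φpos, ∀ γ ∈ Φpos, β + γ = θ →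
        ((β ∈ I ∧ γ ∉ I) ∨ (β ∉ I ∧ γ ∈ I))) ↔
      stdC n 1 + stdC n n ∈ I := by
  subst hθ
  have hpos : ∀ j, 1 ≤ j → j ≤ n → stdC n 1 + stdC n j ∈ Φpos := by
    intro j hj hjn
    rw [hΦpos]
    exact ⟨1, j, le_rfl, hjn, Or.inr ⟨hj, rfl⟩⟩
  constructor
  · intro h
    have hneg : stdC n 1 - stdC n n ∈ Φpos := by
      rw [hΦpos]
      exact ⟨1, n, le_rfl, le_rfl, Or.inl ⟨by omega, rfl⟩⟩
    rcases h _ hneg _ (hpos n (by omega) le_rfl) (by rw [two_smul]; abel) with ⟨h, -⟩ | ⟨-, h⟩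
    · refine hIideal _ h _ (hpos n (by omega) le_rfl) ((hrle _ _).2 ⟨Pi.single n 1, ?_⟩)
      rw [Finset.sum_eq_zero]
      · rw [Pi.single_eq_same, Nat.cast_one, one_smul, two_smul]
        abel
      · intro k hk
        rw [Finset.mem_Icc] at hk
        rw [Pi.single_eq_of_ne (by omega), Nat.cast_zero, zero_smul]
    · exact h
  · intro h β hβ γ hγ hsum
    have hmem : ∀ j, 1 ≤ j → j ≤ n → stdC n 1 + stdC n j ∈ I := by
      intro j hj hjn
      refine hIideal _ h _ (hpos j hj hjn)
        ((hrle _ _).2 ⟨fun k => if j ≤ k ∧ k < n then 1 else 0, ?_⟩)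
      rw [sum_indicator_smul_sub (stdC n) hj hjn]
      simp
    have hnot : ¬(β ∈ I ∧ γ ∈ I) := by
      rintro ⟨hβI, hγI⟩
      apply hIab β hβI γ hγI
      rw [hsum, hΦ]
      exact Or.inr ⟨1, le_rfl, by omega, Or.inl rfl⟩
    rw [hΦpos] at hβ hγ
    obtain ⟨j, hj, hjn, rfl | rfl⟩ := exists_eq_stdC_one_add_of_add_eq hn hβ hγ hsum
    · exact Or.inl ⟨hmem j hj hjn, fun hγI => hnot ⟨hmem j hj hjn, hγI⟩⟩
    · exact Or.inr ⟨fun hβI => hnot ⟨hβI, hmem j hj hjn⟩, hmem j hj hjn⟩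
end

section
/- Let n ≥ 1 and consider the type C_n setting in ℝ^n. Every abelian dual order ideal I of Φ⁺ is contained in M = {e_a + e_b : 1 ≤ a ≤ b ≤ n}. (Hence M, the dual order ideal generated by the long simple root 2e_n, is the unique maximal abelian ideal in type C_n.) -/
/-- A telescoping sum weighted by the indicator function of `[b, ∞)`. -/
theorem sum_Ico_ite_smul_sub {R E : Type*} [Ring R] [AddCommGroup E] [Module R E] (f : ℕ → E)
    (r : R) {a b n : ℕ} (hab : a ≤ b) (hbn : b ≤ n) :
    ∑ k ∈ Finset.Ico a n, (if b ≤ k then r else 0) • (f k - f (k + 1)) = r • (f b - f n) := by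
  induction n, hbn using Nat.le_induction with
  | base =>
    rw [sub_self, smul_zero]
    refine Finset.sum_eq_zero fun k hk => ?_
    rw [if_neg (Finset.mem_Ico.mp hk).2.not_ge, zero_smul]
  | succ m hm ih =>
    rw [Finset.sum_Ico_succ_top (hab.trans hm), ih, if_pos hm, ← smul_add, sub_add_sub_cancel]

/-- `2e_b` is a nonnegative integer combination of the simple roots of type `C_n`. -/
theorem exists_two_smul_stdC_eq_sum_simple (n b : ℕ) (hb : 1 ≤ b) (hbn : b ≤ n) :
    ∃ c : ℕ → ℕ, (2 : ℝ) • stdC n b =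
      (∑ k ∈ Finset.Icc 1 (n-1), (c k : ℝ) • (stdC n k - stdC n (k+1)))
        + (c n : ℝ) • ((2 : ℝ) • stdC n n) := by
  refine ⟨fun k => if k = n then 1 else if b ≤ k then 2 else 0, ?_⟩
  have hIcc : Finset.Icc 1 (n - 1) = Finset.Ico 1 n := by
    ext k
    simp only [Finset.mem_Icc, Finset.mem_Ico]
    omega
  have hsum : ∑ k ∈ Finset.Ico 1 n, (((if k = n then 1 else if b ≤ k then 2 else 0 : ℕ) : ℝ)) •
      (stdC n k - stdC n (k+1)) = (2 : ℝ) • (stdC n b - stdC n n) := by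
    rw [← sum_Ico_ite_smul_sub (stdC n) 2 hb hbn]
    refine Finset.sum_congr rfl fun k hk => ?_
    rw [if_neg (Finset.mem_Ico.mp hk).2.ne]
    push_cast
    rfl
  beta_reduce
  rw [hIcc, hsum, if_pos rfl, Nat.cast_one, one_smul, smul_sub, sub_add_cancel]

/-- Type C_n: every abelian dual order ideal of Φ⁺ is contained in
M = {e_a + e_b : 1 ≤ a ≤ b ≤ n}, the dual order ideal generated by the long simple
root 2e_n (so M is the unique maximal abelian ideal). -/
theorem typeC_abelian_ideals_contained_in_M (n : ℕ) (hn : 1 ≤ n)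
    (Φ : Set (Fin n → ℝ))
    (hΦ : Φ = {v | (∃ a b : ℕ, 1 ≤ a ∧ a < b ∧ b ≤ n ∧
          (v = stdC n a + stdC n b ∨ v = stdC n a - stdC n b ∨
           v = -stdC n a + stdC n b ∨ v = -stdC n a - stdC n b)) ∨
        (∃ a : ℕ, 1 ≤ a ∧ a ≤ n ∧
          (v = (2 : ℝ) • stdC n a ∨ v = -((2 : ℝ) • stdC n a)))})
    (Φpos : Set (Fin n → ℝ))
    (hΦpos : Φpos = {v | ∃ a b : ℕ, 1 ≤ a ∧ b ≤ n ∧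
        ((a < b ∧ v = stdC n a - stdC n b) ∨ (a ≤ b ∧ v = stdC n a + stdC n b))})
    (rle : (Fin n → ℝ) → (Fin n → ℝ) → Prop)
    (hrle : ∀ β γ, rle β γ ↔ ∃ c : ℕ → ℕ,
        γ - β = (∑ k ∈ Finset.Icc 1 (n-1), (c k : ℝ) • (stdC n k - stdC n (k+1)))
          + (c n : ℝ) • ((2 : ℝ) • stdC n n))
    (M : Set (Fin n → ℝ))
    (hM : M = {v | ∃ a b : ℕ, 1 ≤ a ∧ a ≤ b ∧ b ≤ n ∧ v = stdC n a + stdC n b})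
    (I : Set (Fin n → ℝ)) (hIΦ : I ⊆ Φpos)
    (hIideal : ∀ β ∈ I, ∀ γ ∈ Φpos, rle β γ → γ ∈ I)
    (hIab : ∀ β ∈ I, ∀ γ ∈ I, β + γ ∉ Φ) :
    I ⊆ M := by
  subst hΦ hΦpos hM
  intro v hv
  obtain ⟨a, b, ha, hb, ⟨hab, rfl⟩ | ⟨hab, rfl⟩⟩ := hIΦ hv
  · have hle : rle (stdC n a - stdC n b) (stdC n a + stdC n b) := by
      rw [hrle, add_sub_sub_cancel, ← two_smul ℝ (stdC n b)]
      exact exists_two_smul_stdC_eq_sum_simple n b (ha.trans hab.le) hb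
    have hmem := hIideal _ hv _ ⟨a, b, ha, hb, Or.inr ⟨hab.le, rfl⟩⟩ hle
    refine absurd (Or.inr ⟨a, ha, hab.le.trans hb, Or.inl ?_⟩) (hIab _ hv _ hmem)
    rw [two_smul]
    abel
  · exact ⟨a, b, ha, hab, hb, rfl⟩
end
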